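/- Let A be a Cevian arrangement of apical hyperplanes over a point basis N̂ of a projective geometry P, with associated graph Γ = (N, E), rank function rk_P(S) := codim ⋂_{e∈S} h(ê), and B := {circles C of Γ : rk_P(C) < #C}. Then: (1) B is a linear class, so Ω(A) := (Γ, B) is a biased graph; (2) e ↦ h(ê) is an isomorphism of the frame matroid G(Ω(A)) onto the matroid M(A) of the hyperplanes (whose rank function is the codimension of the intersection); (3) the intersection flats of A correspond to the closed sets of G(Ω(A)) via t ↦ {e ∈ E : h(ê) ⊇ t}; and (4) a connected edge set S of Ω(A) is unbalanced if and only if ⋂_{e∈S} h(ê) is an intersection of node hyperplanes. -/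

import Mathlib

open scoped Classical

/-! ## Graphs with parallel links and half edges -/

/-- A multigraph: each edge has a finite set of endpoints
(one endpoint for a half edge, two endpoints for a link). -/
structure MGraph (N : Type*) (E : Type*) where
  ends : E → Finset N

namespace MGraph

variable {N E : Type*} (G : MGraph N E)

/-- A link has two distinct endpoints. -/
def IsLink (e : E) : Prop := (G.ends e).card = 2

/-- A half edge has exactly one endpoint. -/
def IsHalfEdge (e : E) : Prop := (G.ends e).card = 1

/-- The set of nodes of a set of edges. -/
def nodeSet (S : Set E) : Set N := {v | ∃ e ∈ S, v ∈ G.ends e}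

/-- The nodes of a finite set of edges. -/
noncomputable def nodesOf (S : Finset E) : Finset N := S.biUnion G.ends

/-- The degree of a node in a finite edge set. -/
noncomputable def degreeIn (S : Finset E) (v : N) : ℕ :=
  (S.filter (fun e => v ∈ G.ends e)).card

/-- Two nodes joined by an edge of `S`. -/
def adjIn (S : Set E) (u v : N) : Prop := ∃ e ∈ S, u ∈ G.ends e ∧ v ∈ G.ends e

/-- Connectivity of nodes through edges of `S`. -/
def nodeConn (S : Set E) : N → N → Prop := Relation.ReflTransGen (G.adjIn S)

/-- The components of the spanning subgraph `(N, S)`, as sets of nodes. -/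
def components (S : Set E) : Set (Set N) := {W | ∃ v : N, W = {u | G.nodeConn S u v}}

/-- The number of components of the spanning subgraph `(N, S)`. -/
noncomputable def numComponents (S : Set E) : ℕ := Nat.card ↥(G.components S)

/-- The components of the non-spanning subgraph `(N(S), S)`. -/
def componentsOn (S : Set E) : Set (Set N) :=
  {W | ∃ v ∈ G.nodeSet S, W = {u | G.nodeConn S u v}}

/-- The edges of `S` whose endpoints all lie in a node set `W`. -/
def edgesIn (S : Set E) (W : Set N) : Set E := {e | e ∈ S ∧ ∀ v ∈ G.ends e, v ∈ W}

/-- An edge set is connected if any two of its edges are joined through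
consecutively intersecting edges of the set. -/
def ConnEdges (S : Set E) : Prop :=
  ∀ e ∈ S, ∀ f ∈ S, Relation.ReflTransGen
    (fun a b => a ∈ S ∧ b ∈ S ∧ ∃ v : N, v ∈ G.ends a ∧ v ∈ G.ends b) e f

/-- A circle: the edge set of a connected subgraph in which every node has degree 2. -/
def IsCircle (C : Finset E) : Prop :=
  C.Nonempty ∧ (∀ e ∈ C, G.IsLink e) ∧ G.ConnEdges ↑C ∧
    ∀ v ∈ G.nodesOf C, G.degreeIn C v = 2

/-- A (simple, open) path joining two distinct nodes `u` and `v`. -/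
def IsPath (Q : Finset E) (u v : N) : Prop :=
  Q.Nonempty ∧ u ≠ v ∧ (∀ e ∈ Q, G.IsLink e) ∧ G.ConnEdges ↑Q ∧
    u ∈ G.nodesOf Q ∧ v ∈ G.nodesOf Q ∧
    G.degreeIn Q u = 1 ∧ G.degreeIn Q v = 1 ∧
    ∀ w ∈ G.nodesOf Q, w ≠ u → w ≠ v → G.degreeIn Q w = 2

/-- A simple graph: all edges are links and no two edges have the same endpoints. -/
def IsSimple : Prop := (∀ e : E, G.IsLink e) ∧ Function.Injective G.ends

/-- The graph is connected. -/
def IsConnected : Prop := ∀ u v : N, G.nodeConn Set.univ u v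

/-- Inseparable graph: connected, and for every partition of the edge set into two
nonempty parts the two parts share at least two nodes. -/
def IsInseparable : Prop :=
  G.IsConnected ∧ ∀ A B : Set E, A.Nonempty → B.Nonempty → Disjoint A B →
    A ∪ B = Set.univ → ∃ u v : N, u ≠ v ∧ u ∈ G.nodeSet A ∧ u ∈ G.nodeSet B ∧
      v ∈ G.nodeSet A ∧ v ∈ G.nodeSet B

/-- A linear class of circles: every member is a circle and no theta subgraph (the
union of three pairwise internally disjoint paths with the same two endpoints)
contains exactly two members of the class. -/
def IsLinearClass (B : Set (Finset E)) : Prop :=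
  (∀ C ∈ B, G.IsCircle C) ∧
  ∀ u v : N, ∀ P₁ P₂ P₃ : Finset E,
    G.IsPath P₁ u v → G.IsPath P₂ u v → G.IsPath P₃ u v →
    Disjoint P₁ P₂ → Disjoint P₁ P₃ → Disjoint P₂ P₃ →
    (↑(G.nodesOf P₁) ∩ ↑(G.nodesOf P₂) : Set N) = {u, v} →
    (↑(G.nodesOf P₁) ∩ ↑(G.nodesOf P₃) : Set N) = {u, v} →
    (↑(G.nodesOf P₂) ∩ ↑(G.nodesOf P₃) : Set N) = {u, v} →
    P₁ ∪ P₂ ∈ B → P₁ ∪ P₃ ∈ B → P₂ ∪ P₃ ∈ B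

/-- A balanced edge set with respect to a class `B` of balanced circles:
no half edges, and every circle inside it belongs to `B`. -/
def IsBalancedSet (B : Set (Finset E)) (S : Set E) : Prop :=
  (∀ e ∈ S, G.IsLink e) ∧ ∀ C : Finset E, ↑C ⊆ S → G.IsCircle C → C ∈ B

/-- The number of balanced components of the spanning subgraph `(N, S)`. -/
noncomputable def numBalComponents (B : Set (Finset E)) (S : Set E) : ℕ :=
  Nat.card ↥{W : Set N | W ∈ G.components S ∧ G.IsBalancedSet B (G.edgesIn S W)}

/-- Frame matroid rank function: `rk S = #N - b(S)`. -/
noncomputable def frameRk [Fintype N] (B : Set (Finset E)) (S : Set E) : ℕ :=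
  Fintype.card N - G.numBalComponents B S

/-- Graphic (cycle) matroid rank function: `rk S = #N - c(S)`. -/
noncomputable def graphicRk [Fintype N] (S : Set E) : ℕ :=
  Fintype.card N - G.numComponents S

/-- Graphic matroid rank of a finite edge set, computed inside its own node set
(valid also for infinite graphs): `rk S = #N(S) - c(N(S), S)`. -/
noncomputable def graphicRkOn (S : Finset E) : ℕ :=
  (G.nodesOf S).card - Nat.card ↥(G.componentsOn ↑S)

/-- Extended lift matroid rank function on `E ⊕ Unit`, where `Sum.inr ()` is the
extra point `e₀`: `rk S = #N - c(S ∩ E)` if `S ⊆ E` is balanced, and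
`#N - c(S ∩ E) + 1` if `S` is unbalanced or contains `e₀`. -/
noncomputable def liftRk [Fintype N] (B : Set (Finset E)) (S : Set (E ⊕ Unit)) : ℕ :=
  if G.IsBalancedSet B {e | Sum.inl e ∈ S} ∧ Sum.inr () ∉ S then
    Fintype.card N - G.numComponents {e | Sum.inl e ∈ S}
  else Fintype.card N - G.numComponents {e | Sum.inl e ∈ S} + 1

/-- Closed sets of the frame matroid (via the rank function; the matroid is finitary). -/
def FrameClosed [Fintype N] (B : Set (Finset E)) (S : Set E) : Prop :=
  ∀ e : E, (∃ S₀ : Finset E, ↑S₀ ⊆ S ∧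
    G.frameRk B ↑(insert e S₀) = G.frameRk B ↑S₀) → e ∈ S

/-- Closed sets of the extended lift matroid. -/
def LiftClosed [Fintype N] (B : Set (Finset E)) (S : Set (E ⊕ Unit)) : Prop :=
  ∀ x : E ⊕ Unit, (∃ S₀ : Finset (E ⊕ Unit), ↑S₀ ⊆ S ∧
    G.liftRk B ↑(insert x S₀) = G.liftRk B ↑S₀) → x ∈ S

/-- The balance-closure of an edge set. -/
def bcl (B : Set (Finset E)) (S : Set E) : Set E :=
  S ∪ {e | ∃ C ∈ B, e ∈ C ∧ ↑C ⊆ S ∪ {e}}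

/-- The subgraph of all links, as a graph on the same nodes. -/
def linkGraph : MGraph N {e : E // G.IsLink e} := ⟨fun e => G.ends e.val⟩

/-- Restriction of a class of circles to the subgraph of links. -/
def linkBal (B : Set (Finset E)) : Set (Finset {e : E // G.IsLink e}) :=
  {C | C.image Subtype.val ∈ B}

/-- The subgraph on a subset of the edges (spanning all nodes). -/
def sub (D : Set E) : MGraph N ↥D := ⟨fun f => G.ends f.val⟩

end MGraph

/-- A graph together with a distinguished class of "balanced" circles.
(It is a biased graph when the class is a linear class.) -/
structure BiasedGraph (N E : Type*) extends MGraph N E where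
  Bal : Set (Finset E)

/-- The complete graph on a node set `N`. -/
def completeMGraph (N : Type*) : MGraph N {q : Finset N // q.card = 2} := ⟨Subtype.val⟩

/-- A gain graph with gain group `Γ`: each edge is given by a source, a target
(equal for a half edge) and a gain in the direction from source to target. -/
structure GainGraph (N E : Type*) (Γ : Type*) [Group Γ] extends MGraph N E where
  src : E → N
  tgt : E → N
  gain : E → Γ
  ends_eq : ∀ e : E, ends e = {src e, tgt e}

namespace GainGraph

variable {N E Γ : Type*} [Group Γ] (Φ : GainGraph N E Γ)

/-- The gain of an edge in the direction from `u` to `v`. -/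
noncomputable def ogain (e : E) (u v : N) : Γ :=
  if Φ.src e = u ∧ Φ.tgt e = v then Φ.gain e else (Φ.gain e)⁻¹

/-- A balanced circle of a gain graph: a circle whose gain function is given by a
potential on the nodes (equivalently, the product of its gains along a cyclic
orientation is the identity). -/
def BalancedCircle (C : Finset E) : Prop :=
  Φ.toMGraph.IsCircle C ∧
    ∃ θ : N → Γ, ∀ e ∈ C, Φ.gain e = (θ (Φ.src e))⁻¹ * θ (Φ.tgt e)

/-- The biased graph `⟨Φ⟩` of a gain graph. -/
def biasedGraph : BiasedGraph N E := { Φ.toMGraph with Bal := {C | Φ.BalancedCircle C} }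

end GainGraph

/-- A biased expansion of a graph `Δ` along a projection `p`: `p` is surjective,
preserves endpoints, and every circle of `Δ` with a chosen lift of all but one of
its edges has a unique completion to a balanced circle. -/
def IsBiasedExpansion {N E E' : Type*} (G : MGraph N E) (B : Set (Finset E))
    (Δ : MGraph N E') (p : E → E') : Prop :=
  Function.Surjective p ∧ (∀ e : E, G.ends e = Δ.ends (p e)) ∧
  ∀ C : Finset E', Δ.IsCircle C → ∀ e₀ ∈ C, ∀ s : E' → E,
    (∀ f ∈ C.erase e₀, p (s f) = f) →
    ∃! t : E, p t = e₀ ∧ (C.erase e₀).image s ∪ {t} ∈ B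

/-! ## Axiomatic (synthetic) projective geometry -/

/-- An axiomatic projective geometry: a point set with a line through any two
points, unique when the points are distinct, every line having at least three
points, and satisfying the Veblen–Young axiom. -/
structure ProjGeom (P : Type*) where
  line : P → P → Set P
  line_self : ∀ p : P, line p p = {p}
  line_symm : ∀ p q : P, line p q = line q p
  left_mem_line : ∀ p q : P, p ∈ line p q
  right_mem_line : ∀ p q : P, q ∈ line p q
  line_unique : ∀ p q x y : P, p ≠ q → x ∈ line p q → y ∈ line p q → x ≠ y →
    line x y = line p q
  exists_third : ∀ p q : P, p ≠ q → ∃ r ∈ line p q, r ≠ p ∧ r ≠ q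
  veblen : ∀ p q r s x : P, p ≠ q → r ≠ s → p ≠ r → q ≠ s →
    x ∈ line p q → x ∈ line r s → ∃ y, y ∈ line p r ∧ y ∈ line q s

namespace ProjGeom

variable {P : Type*} (G : ProjGeom P)

/-- A flat (subspace): a line-closed set of points. -/
def IsFlat (t : Set P) : Prop := ∀ p ∈ t, ∀ q ∈ t, G.line p q ⊆ t

/-- The span of a point set: the smallest flat containing it. -/
def span (A : Set P) : Set P := ⋂₀ {t : Set P | G.IsFlat t ∧ A ⊆ t}

/-- An independent point set: no point is in the span of the others. -/
def Indep (A : Set P) : Prop := ∀ a ∈ A, a ∉ G.span (A \ {a})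

/-- The (matroid) rank of a point set: the largest cardinality of a finite
independent subset. -/
noncomputable def rank (A : Set P) : ℕ :=
  sSup {n : ℕ | ∃ B : Finset P, ↑B ⊆ A ∧ G.Indep ↑B ∧ B.card = n}

/-- A hyperplane: a maximal proper flat. -/
def IsHyperplane (h : Set P) : Prop :=
  G.IsFlat h ∧ h ≠ Set.univ ∧ ∀ t : Set P, G.IsFlat t → h ⊆ t → t = h ∨ t = Set.univ

/-- The codimension of a flat: the least number of hyperplanes intersecting in it. -/
noncomputable def codim (t : Set P) : ℕ :=
  sInf {n : ℕ | ∃ H : Finset (Set P), H.card = n ∧ (∀ h ∈ H, G.IsHyperplane h) ∧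
    ⋂₀ ↑H = t}

variable {N : Type*}

/-- A cross-flat with respect to an independent family `ν`: a flat containing
none of the points `ν v`. -/
def crossFlat (ν : N → P) (t : Set P) : Prop := G.IsFlat t ∧ ∀ v : N, ν v ∉ t

/-- The union of all edge lines of the independent family `ν`. -/
def edgeLineUnion (ν : N → P) : Set P :=
  ⋃ (v : N) (w : N) (_ : v ≠ w), G.line (ν v) (ν w)

/-! ### The Menelaean (point) construction for the frame matroid -/

/-- The underlying graph of the Menelaean construction `Ω(N̂, Ehat)`: a point of `Ehat`
in `N̂` is a half edge, any other point is a link joining the ends of its edge line. -/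
noncomputable def menGraph (ν : N → P) (Ehat : Set P)
    (hE : ∀ x ∈ Ehat, x ∉ Set.range ν →
      ∃ pr : N × N, pr.1 ≠ pr.2 ∧ x ∈ G.line (ν pr.1) (ν pr.2)) :
    MGraph N ↥Ehat where
  ends e :=
    if h : (e : P) ∈ Set.range ν then {(show ∃ v : N, ν v = ↑e from h).choose}
    else {(hE e e.2 h).choose.1, (hE e e.2 h).choose.2}

/-- The balanced circles of the Menelaean construction: circles whose point set
lies in a cross-flat. -/
noncomputable def menBal (ν : N → P) (Ehat : Set P)
    (hE : ∀ x ∈ Ehat, x ∉ Set.range ν →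
      ∃ pr : N × N, pr.1 ≠ pr.2 ∧ x ∈ G.line (ν pr.1) (ν pr.2)) :
    Set (Finset ↥Ehat) :=
  {C | (G.menGraph ν Ehat hE).IsCircle C ∧
    ∃ t : Set P, G.crossFlat ν t ∧ ∀ e ∈ C, (e : P) ∈ t}

/-! ### The Cevian (hyperplane) construction for the frame matroid -/

/-- A Cevian arrangement over the point basis `ν`, described by its associated
graph `Γ` and its apex function: a link `e` with endpoints `v, w` has its apex on
the edge line `v̂ŵ`, off the basis; a half edge at `v` has apex `ν v`. -/
def IsCevian {E : Type*} (ν : N → P) (Γ : MGraph N E) (apex : E → P) : Prop :=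
  ∀ e : E,
    (∃ v w : N, v ≠ w ∧ Γ.ends e = ({v, w} : Finset N) ∧
      apex e ∈ G.line (ν v) (ν w) ∧ apex e ∉ Set.range ν) ∨
    (∃ v : N, Γ.ends e = ({v} : Finset N) ∧ apex e = ν v)

/-- The apical hyperplane of an edge of a Cevian arrangement. -/
def cevHyp {E : Type*} (ν : N → P) (Γ : MGraph N E) (apex : E → P) (e : E) : Set P :=
  if Γ.IsLink e then G.span ((ν '' {u : N | u ∉ Γ.ends e}) ∪ {apex e})
  else G.span (ν '' {u : N | u ∉ Γ.ends e})

/-- The rank function of a Cevian arrangement: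
the codimension of the intersection of the corresponding apical hyperplanes. -/
noncomputable def cevRk {E : Type*} (ν : N → P) (Γ : MGraph N E) (apex : E → P)
    (S : Finset E) : ℕ :=
  G.codim (⋂ e ∈ S, G.cevHyp ν Γ apex e)

/-- The balanced circles of a Cevian arrangement:
circles of deficient hyperplane-intersection rank. -/
noncomputable def cevBal {E : Type*} (ν : N → P) (Γ : MGraph N E) (apex : E → P) :
    Set (Finset E) :=
  {C | Γ.IsCircle C ∧ G.cevRk ν Γ apex C < C.card}

/-! ### The orthographic (point) construction for the lift matroid -/

/-- The projection of the orthographic construction: each point of `Ehat` lies on the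
edge line `z'(f)e₀` of a unique edge `f` of `Δ`. -/
noncomputable def orthoProj {E' : Type*} (z' : E' → P) (e₀ : P) (Ehat : Set P)
    (hE : ∀ x ∈ Ehat, ∃ f : E', x ∈ G.line (z' f) e₀) : ↥Ehat → E' :=
  fun e => (hE e e.2).choose

/-- The underlying graph of the orthographic construction `Ω₀(Ehat)`. -/
noncomputable def orthoGraph {E' : Type*} (Δ : MGraph N E') (z' : E' → P) (e₀ : P)
    (Ehat : Set P) (hE : ∀ x ∈ Ehat, ∃ f : E', x ∈ G.line (z' f) e₀) : MGraph N ↥Ehat :=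
  ⟨fun e => Δ.ends (G.orthoProj z' e₀ Ehat hE e)⟩

/-- The balanced circles of the orthographic construction:
circles spanning a cross-flat (a flat not containing `e₀`). -/
noncomputable def orthoBal {E' : Type*} (Δ : MGraph N E') (z' : E' → P) (e₀ : P)
    (Ehat : Set P) (hE : ∀ x ∈ Ehat, ∃ f : E', x ∈ G.line (z' f) e₀) : Set (Finset ↥Ehat) :=
  {C | (G.orthoGraph Δ z' e₀ Ehat hE).IsCircle C ∧
    e₀ ∉ G.span (Subtype.val '' (↑C : Set ↥Ehat))}

end ProjGeom

/-! ### Synthetic affinographic arrangements -/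

/-- A synthetic affinographic arrangement of hyperplanes in the affine geometry
obtained from the projective geometry `G` by deleting the ideal hyperplane `hinf`:
a family of hyperplanes `hP e` (given by their projective completions, with affine
parts `hP e \ hinf`), with parallel classes indexed by the edges of a graph `Δ` with
links only via the surjection `π`; hyperplanes in the class of `f` have common
ideal part `ideal f`, and the matroid of the ideal parts (rank = codimension inside
`hinf`) is the graphic matroid of `Δ`. -/
def IsAffinographic {P N E E' : Type*} [Fintype N] (G : ProjGeom P) (hinf : Set P)
    (hP : E → Set P) (Δ : MGraph N E') (π : E → E') (ideal : E' → Set P) : Prop :=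
  G.IsHyperplane hinf ∧ (∀ f : E', Δ.IsLink f) ∧ Function.Surjective π ∧
  Function.Injective hP ∧ Function.Injective ideal ∧
  (∀ e : E, G.IsHyperplane (hP e) ∧ hP e ≠ hinf ∧ hP e ∩ hinf = ideal (π e)) ∧
  ∀ S : Finset E', Δ.graphicRk (↑S : Set E') = G.codim (hinf ∩ ⋂ f ∈ S, ideal f) - 1

/-- The underlying graph of the biased graph `Ω(A)` of an affinographic
arrangement: each edge of `Δ` is replaced by the edges of its parallel class. -/
def affinoGraph {N E E' : Type*} (Δ : MGraph N E') (π : E → E') : MGraph N E :=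
  ⟨fun e => Δ.ends (π e)⟩

/-- The affine intersection `t_A(S)` of the hyperplanes of `S`. -/
def affInter {P E : Type*} (hinf : Set P) (hP : E → Set P) (S : Set E) : Set P :=
  ⋂ e ∈ S, (hP e \ hinf)

/-- The balanced circles of `Ω(A)`: digons over a single edge of `Δ` are unbalanced;
any other circle is balanced iff its affine intersection is nonempty. -/
def affinoBal {P N E E' : Type*} (_G : ProjGeom P) (hinf : Set P) (hP : E → Set P)
    (Δ : MGraph N E') (π : E → E') : Set (Finset E) :=
  {C | (affinoGraph Δ π).IsCircle C ∧ ¬(∃ f : E', ∀ e ∈ C, π e = f) ∧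
    (affInter hinf hP ↑C).Nonempty}

/-! ### Coordinatized projective spaces -/

/-- The rank of a finite set of points of a coordinatized projective space:
the dimension of the linear span of representative vectors. -/
noncomputable def projRank (F : Type*) {V : Type*} [DivisionRing F] [AddCommGroup V]
    [Module F V] (A : Finset (Projectivization F V)) : ℕ :=
  Module.finrank F ↥(Submodule.span F (Projectivization.rep '' (↑A : Set (Projectivization F V))))

/-- The edge set of the full biased graph `Ω^•`: the edges of `Ω` together with a
new half edge at every node not already supporting one. -/
def FullE {N E : Type*} (Ω : BiasedGraph N E) : Type _ :=
  E ⊕ {v : N // ∀ e : E, Ω.ends e ≠ ({v} : Finset N)}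

/-- The underlying graph of the full biased graph `Ω^•`. -/
def fullGraph {N E : Type*} (Ω : BiasedGraph N E) : MGraph N (FullE Ω) :=
  ⟨Sum.elim Ω.ends (fun v => {v.val})⟩

/-- The balanced circles of the full biased graph `Ω^•` (circles avoid half edges). -/
def fullBal {N E : Type*} (Ω : BiasedGraph N E) : Set (Finset (FullE Ω)) :=
  {C | ∃ C₀ ∈ Ω.Bal, C = C₀.image Sum.inl}

/-! ## Statement 9 -/


namespace ProjGeom
section geo
variable {P : Type*} (G : ProjGeom P)

theorem flat_span (A : Set P) : G.IsFlat (G.span A) := by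
  intro p hp q hq x hx t ht
  exact ht.1 p (hp t ht) q (hq t ht) hx

theorem sub_span (A : Set P) : A ⊆ G.span A := fun _ hx _ ht => ht.2 hx

theorem span_le {A t : Set P} (ht : G.IsFlat t) (h : A ⊆ t) : G.span A ⊆ t :=
  fun _ hx => hx t ⟨ht, h⟩

theorem span_mono' {A B : Set P} (h : A ⊆ B) : G.span A ⊆ G.span B :=
  G.span_le (G.flat_span B) (h.trans (G.sub_span B))

theorem span_empty' : G.span ∅ = ∅ := by
  apply Set.eq_empty_of_subset_empty
  exact G.span_le (fun p hp => hp.elim) (Set.empty_subset _)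

theorem flat_singleton (p : P) : G.IsFlat {p} := by
  intro a ha b hb
  rw [Set.mem_singleton_iff.1 ha, Set.mem_singleton_iff.1 hb, G.line_self]

theorem flat_inter {s t : Set P} (hs : G.IsFlat s) (ht : G.IsFlat t) : G.IsFlat (s ∩ t) :=
  fun p hp q hq => Set.subset_inter (hs p hp.1 q hq.1) (ht p hp.2 q hq.2)

theorem flat_biInter {ι : Type*} (S : Set ι) (f : ι → Set P) (h : ∀ i ∈ S, G.IsFlat (f i)) :
    G.IsFlat (⋂ i ∈ S, f i) := by
  intro p hp q hq x hx
  simp only [Set.mem_iInter] at *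
  exact fun i hi => h i hi p (hp i hi) q (hq i hi) hx

theorem line_flip {a b c : P} (h : c ∈ G.line a b) (hca : c ≠ a) : b ∈ G.line a c := by
  by_cases hab : a = b
  · subst hab; rw [G.line_self] at h; exact absurd h hca
  · rw [G.line_unique a b a c hab (G.left_mem_line _ _) h (Ne.symm hca)]
    exact G.right_mem_line _ _

/-- c on line ab, c, a in flat, c ≠ a -> b in flat -/
theorem flat_flip {t : Set P} (ht : G.IsFlat t) {a b c : P} (h : c ∈ G.line a b) (hca : c ≠ a)
    (ha : a ∈ t) (hc : c ∈ t) : b ∈ t := ht a ha c hc (G.line_flip h hca)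

theorem flat_flip' {t : Set P} (ht : G.IsFlat t) {a b c : P} (h : c ∈ G.line b a) (hca : c ≠ a)
    (ha : a ∈ t) (hc : c ∈ t) : b ∈ t := by
  rw [G.line_symm] at h; exact G.flat_flip ht h hca ha hc

theorem pasch {a b c d e : P} (hc : c ∈ G.line a b) (hd : d ∈ G.line c e) :
    ∃ f ∈ G.line a e, d ∈ G.line f b := by
  by_cases hde : d = e
  · subst hde; exact ⟨d, G.right_mem_line _ _, G.left_mem_line _ _⟩
  by_cases hab : a = b
  · subst hab
    rw [G.line_self, Set.mem_singleton_iff] at hc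
    subst hc
    exact ⟨d, hd, G.left_mem_line _ _⟩
  by_cases hbd : b = d
  · subst hbd; exact ⟨a, G.left_mem_line _ _, G.right_mem_line _ _⟩
  have hfl : G.IsFlat (G.line a b) := by
    intro x hx y hy
    by_cases hxy : x = y
    · subst hxy; rw [G.line_self]; simpa using hx
    · rw [G.line_unique a b x y hab hx hy hxy]
  by_cases hae : a = e
  · subst hae
    exact ⟨a, G.left_mem_line _ _, hfl c hc a (G.left_mem_line _ _) hd⟩
  have hced : c ∈ G.line e d := by
    rw [G.line_symm] at hd
    exact G.line_flip hd hde
  obtain ⟨y, hy1, hy2⟩ := G.veblen a b e d c hab (Ne.symm hde) hae hbd hc hced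
  by_cases hyb : y = b
  · subst hyb
    have he : e ∈ G.line a y := G.line_flip hy1 (Ne.symm hab)
    exact ⟨a, G.left_mem_line _ _, hfl c hc e he hd⟩
  · refine ⟨y, hy1, ?_⟩
    rw [G.line_symm]; exact G.line_flip hy2 hyb

def join (X Y : Set P) : Set P := X ∪ Y ∪ {z | ∃ x ∈ X, ∃ y ∈ Y, z ∈ G.line x y}

theorem join_aux {X Y : Set P} (hX : G.IsFlat X) (hY : G.IsFlat Y) {x1 y1 x2 y2 z1 z2 z : P}
    (hx1 : x1 ∈ X) (hx2 : x2 ∈ X) (hy1 : y1 ∈ Y) (hy2 : y2 ∈ Y) (h1 : z1 ∈ G.line x1 y1)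
    (h2 : z2 ∈ G.line x2 y2) (hz : z ∈ G.line z1 z2) : ∃ x ∈ X, ∃ y ∈ Y, z ∈ G.line x y := by
  rw [G.line_symm] at hz
  obtain ⟨w, hw, hzw⟩ := G.pasch h2 hz
  rw [G.line_symm] at hw
  obtain ⟨u, hu, hwu⟩ := G.pasch h1 hw
  rw [G.line_symm] at hwu
  obtain ⟨s, hs, hzs⟩ := G.pasch hwu hzw
  exact ⟨u, hX _ hx1 _ hx2 hu, s, hY _ hy1 _ hy2 hs, by rwa [G.line_symm]⟩

theorem flat_join {X Y : Set P} (hX : G.IsFlat X) (hY : G.IsFlat Y) : G.IsFlat (G.join X Y) := by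
  rcases X.eq_empty_or_nonempty with rfl | ⟨x0, hx0⟩
  · simpa [join] using hY
  rcases Y.eq_empty_or_nonempty with rfl | ⟨y0, hy0⟩
  · simpa [join] using hX
  have key : ∀ z ∈ G.join X Y, ∃ x ∈ X, ∃ y ∈ Y, z ∈ G.line x y := by
    rintro z ((hz | hz) | hz)
    · exact ⟨z, hz, y0, hy0, G.left_mem_line _ _⟩
    · exact ⟨x0, hx0, z, hz, G.right_mem_line _ _⟩
    · exact hz
  intro p hp q hq z hz
  obtain ⟨x1, hx1, y1, hy1, h1⟩ := key p hp
  obtain ⟨x2, hx2, y2, hy2, h2⟩ := key q hq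
  exact Or.inr (G.join_aux hX hY hx1 hx2 hy1 hy2 h1 h2 hz)

theorem span_union_sub (A B : Set P) : G.span (A ∪ B) ⊆ G.join (G.span A) (G.span B) := by
  apply G.span_le (G.flat_join (G.flat_span _) (G.flat_span _))
  apply Set.union_subset
  · exact fun x hx => Or.inl (Or.inl (G.sub_span _ hx))
  · exact fun x hx => Or.inl (Or.inr (G.sub_span _ hx))

theorem span_flat {t : Set P} (ht : G.IsFlat t) : G.span t = t :=
  Set.Subset.antisymm (G.span_le ht subset_rfl) (G.sub_span _)

/-- every point of span (A ∪ {p}) is p, or in A, or on a line -/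
theorem mem_span_insert {A : Set P} {p z : P} (hz : z ∈ G.span (A ∪ {p})) :
    z = p ∨ ∃ x ∈ G.span A, z ∈ G.line x p := by
  have := G.span_union_sub _ _ hz
  rw [G.span_flat (G.flat_singleton p)] at this
  rcases this with (h | h) | ⟨x, hx, y, hy, h⟩
  · exact Or.inr ⟨z, h, G.left_mem_line _ _⟩
  · exact Or.inl h
  · rw [Set.mem_singleton_iff.1 hy] at h
    exact Or.inr ⟨x, hx, h⟩

theorem hyper_of {h : Set P} (hf : G.IsFlat h) {p : P} (hp : p ∉ h)
    (hs : G.span (h ∪ {p}) = Set.univ) : G.IsHyperplane h := by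
  refine ⟨hf, fun hu => hp (hu ▸ Set.mem_univ p), fun t ht hht => ?_⟩
  by_cases htt : t ⊆ h
  · exact Or.inl (Set.Subset.antisymm htt hht)
  right
  obtain ⟨q, hqt, hqh⟩ := Set.not_subset.1 htt
  have hpt : p ∈ t := by
    rcases G.mem_span_insert (hs ▸ Set.mem_univ q : q ∈ G.span (h ∪ {p})) with h1 | ⟨x, hx, h1⟩
    · rwa [← h1]
    · rw [G.span_flat hf] at hx
      exact G.flat_flip ht h1 (fun h => hqh (h ▸ hx)) (hht hx) hqt
  rw [← Set.univ_subset_iff, ← hs]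
  exact G.span_le ht (Set.union_subset hht (by simpa using hpt))

theorem hyper_meet {h : Set P} (hh : G.IsHyperplane h) {p q : P} (hp : p ∉ h) (hqp : q ≠ p) :
    ∃ r ∈ h, q ∈ G.line r p := by
  have : G.span (h ∪ {p}) = Set.univ := by
    rcases hh.2.2 _ (G.flat_span (h ∪ {p})) (Set.subset_union_left.trans (G.sub_span _)) with h1 | h1
    · exact absurd (h1 ▸ G.sub_span (h ∪ {p}) (Or.inr rfl)) hp
    · exact h1
  rcases G.mem_span_insert (this ▸ Set.mem_univ q : q ∈ G.span (h ∪ {p})) with h1 | ⟨x, hx, h1⟩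
  · exact absurd h1 hqp
  · rw [G.span_flat hh.1] at hx; exact ⟨x, hx, h1⟩

theorem exch {X h1 h2 : Set P} (hX : G.IsFlat X) (hf1 : G.IsFlat h1) (hh2 : G.IsHyperplane h2)
    (hs : X ∩ h2 ⊆ h1) (hn : ¬ X ⊆ h1) : X ∩ h1 ⊆ h2 := by
  rintro q ⟨hqX, hq1⟩
  by_contra hq2
  obtain ⟨p, hpX, hp1⟩ := Set.not_subset.1 hn
  have hpq : p ≠ q := fun h => hp1 (h ▸ hq1)
  obtain ⟨r, hr, hpr⟩ := G.hyper_meet hh2 hq2 hpq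
  have hrX : r ∈ X := G.flat_flip' hX hpr hpq hqX hpX
  exact hp1 (hf1 _ (hs ⟨hrX, hr⟩) _ hq1 hpr)

/-! independence of finite sets of hyperplanes -/
def HInd (I : Finset (Set P)) : Prop := ∀ i ∈ I, ¬ (⋂₀ (↑(I.erase i) : Set (Set P)) ⊆ i)

theorem flat_sInter {I : Finset (Set P)} (h : ∀ i ∈ I, G.IsHyperplane i) :
    G.IsFlat (⋂₀ (↑I : Set (Set P))) := by
  intro p hp q hq x hx i hi
  exact (h i (by simpa using hi)).1 p (hp i hi) q (hq i hi) hx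

theorem exch_find {X h : Set P} (hX : G.IsFlat X) (hh : G.IsFlat h)
    (T : Finset (Set P)) (hT : ∀ t ∈ T, G.IsHyperplane t)
    (hs : X ∩ ⋂₀ (↑T : Set (Set P)) ⊆ h) (hn : ¬ X ⊆ h) :
    ∃ t ∈ T, X ∩ h ∩ ⋂₀ (↑(T.erase t) : Set (Set P)) ⊆ t := by
  induction T using Finset.induction_on with
  | empty => simp at hs; exact absurd hs hn
  | insert t T ht ih =>
    have hT' : ∀ t ∈ T, G.IsHyperplane t := fun t ht => hT t (Finset.mem_insert_of_mem ht)
    by_cases hc : X ∩ ⋂₀ (↑T : Set (Set P)) ⊆ h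
    · obtain ⟨s, hs1, hs2⟩ := ih hT' hc
      refine ⟨s, Finset.mem_insert_of_mem hs1, ?_⟩
      refine Set.Subset.trans ?_ hs2
      apply Set.inter_subset_inter_right
      apply Set.sInter_subset_sInter
      intro x hx
      simp only [Finset.coe_erase, Finset.coe_insert] at *
      exact ⟨Or.inr hx.1, hx.2⟩
    · refine ⟨t, Finset.mem_insert_self _ _, ?_⟩
      rw [Finset.erase_insert ht]
      have := G.exch (G.flat_inter hX (G.flat_sInter hT')) hh (hT t (Finset.mem_insert_self _ _))
        (by
          refine Set.Subset.trans ?_ hs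
          rw [Finset.coe_insert, Set.sInter_insert]
          rintro x ⟨⟨a, b⟩, c⟩; exact ⟨a, c, b⟩) hc
      rintro x ⟨⟨a, b⟩, c⟩; exact this ⟨⟨a, c⟩, b⟩

theorem steinitz_aux (n : ℕ) : ∀ (X : Set P) (I T : Finset (Set P)), I.card = n → G.IsFlat X →
    (∀ i ∈ I, G.IsFlat i) → (∀ t ∈ T, G.IsHyperplane t) →
    (∀ i ∈ I, ¬ (X ∩ ⋂₀ (↑(I.erase i) : Set (Set P)) ⊆ i)) →
    (∀ i ∈ I, X ∩ ⋂₀ (↑T : Set (Set P)) ⊆ i) → n ≤ T.card := by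
  induction n with
  | zero => intros; exact Nat.zero_le _
  | succ n ih =>
    intro X I T hc hX hI hT hind hsub
    have : I.Nonempty := by rw [← Finset.card_pos]; omega
    obtain ⟨i, hi⟩ := this
    obtain ⟨t, ht, hts⟩ := G.exch_find hX (hI i hi) T hT (hsub i hi)
      (fun h => hind i hi (Set.inter_subset_left.trans h))
    have := ih (X ∩ i) (I.erase i) (T.erase t) (by rw [Finset.card_erase_of_mem hi]; omega)
      (G.flat_inter hX (hI i hi)) (fun j hj => hI j (Finset.mem_of_mem_erase hj))
      (fun j hj => hT j (Finset.mem_of_mem_erase hj))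
      (by
        intro j hj hs
        apply hind j (Finset.mem_of_mem_erase hj)
        refine Set.Subset.trans ?_ hs
        rintro x ⟨a, b⟩
        refine ⟨⟨a, b i ?_⟩, fun k hk => b k ?_⟩
        · simp [hi]; exact fun h => (Finset.ne_of_mem_erase hj) h.symm
        · simp at hk ⊢; tauto)
      (by
        intro j hj
        refine Set.Subset.trans ?_ (hsub j (Finset.mem_of_mem_erase hj))
        intro x hx
        refine ⟨hx.1.1, fun k hk => ?_⟩
        by_cases hkt : k = t
        · subst hkt; exact hts hx
        · exact hx.2 k (by simp at hk ⊢; tauto))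
    rw [Finset.card_erase_of_mem ht] at this
    have := Finset.card_pos.2 ⟨t, ht⟩
    omega

theorem steinitz {I T : Finset (Set P)} (hI : ∀ i ∈ I, G.IsHyperplane i)
    (hT : ∀ t ∈ T, G.IsHyperplane t) (hind : HInd I)
    (hsub : ∀ i ∈ I, ⋂₀ (↑T : Set (Set P)) ⊆ i) : I.card ≤ T.card := by
  refine G.steinitz_aux I.card Set.univ I T rfl (fun _ _ _ _ => Set.subset_univ _)
    (fun i hi => (hI i hi).1) hT ?_ ?_
  · simpa only [HInd, Set.univ_inter] using hind
  · simpa only [Set.univ_inter] using hsub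

theorem hind_insert {I : Finset (Set P)} (hI : ∀ i ∈ I, G.IsHyperplane i) (hind : HInd I)
    {r : Set P} (hr : G.IsHyperplane r) (hn : ¬ (⋂₀ (↑I : Set (Set P)) ⊆ r)) :
    r ∉ I ∧ HInd (insert r I) := by
  have hrI : r ∉ I := fun h => hn (Set.sInter_subset_of_mem (by simpa using h))
  refine ⟨hrI, fun i hi hs => ?_⟩
  rcases Finset.mem_insert.1 hi with rfl | hi
  · rw [Finset.erase_insert hrI] at hs; exact hn hs
  · have hne : i ≠ r := fun h => hrI (h ▸ hi)
    rw [Finset.erase_insert_of_ne hne.symm, Finset.coe_insert, Set.sInter_insert] at hs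
    have := G.exch (X := ⋂₀ (↑(I.erase i) : Set (Set P)))
      (G.flat_sInter (fun j hj => hI j (Finset.mem_of_mem_erase hj))) (hI i hi).1 hr
      (by rwa [Set.inter_comm]) (hind i hi)
    apply hn
    refine Set.Subset.trans ?_ this
    intro x hx
    exact ⟨fun k hk => hx k (by simp at hk ⊢; tauto), hx i (by simpa using hi)⟩

theorem codim_wit {T : Finset (Set P)} (hT : ∀ t ∈ T, G.IsHyperplane t) :
    ∃ I : Finset (Set P), I.card = G.codim (⋂₀ (↑T : Set (Set P))) ∧
      (∀ i ∈ I, G.IsHyperplane i) ∧ ⋂₀ (↑I : Set (Set P)) = ⋂₀ (↑T : Set (Set P)) ∧ HInd I := by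
  have hne : {n : ℕ | ∃ H : Finset (Set P), H.card = n ∧ (∀ h ∈ H, G.IsHyperplane h) ∧
    ⋂₀ ↑H = ⋂₀ (↑T : Set (Set P))}.Nonempty := ⟨_, T, rfl, hT, rfl⟩
  obtain ⟨I, h1, h2, h3⟩ := Nat.sInf_mem hne
  refine ⟨I, h1, h2, h3, fun i hi hs => ?_⟩
  have : G.codim (⋂₀ (↑T : Set (Set P))) ≤ (I.erase i).card := by
    apply Nat.sInf_le
    refine ⟨_, rfl, fun j hj => h2 j (Finset.mem_of_mem_erase hj), ?_⟩
    rw [← h3]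
    apply Set.Subset.antisymm
    · intro x hx k hk
      by_cases hki : k = i
      · subst hki; exact hs hx
      · exact hx k (by simp at hk ⊢; tauto)
    · exact Set.sInter_subset_sInter (by simp)
  rw [Finset.card_erase_of_mem hi] at this
  have h4 := Finset.card_pos.2 ⟨i, hi⟩
  unfold codim at this
  omega

end geo
end ProjGeom

namespace MGraph
section gr
variable {N E : Type*} (Γ : MGraph N E)

theorem mem_nodesOf {S : Finset E} {v : N} : v ∈ Γ.nodesOf S ↔ ∃ e ∈ S, v ∈ Γ.ends e := by
  simp [nodesOf]

theorem deg_sum {C : Finset E} (hC : ∀ e ∈ C, Γ.IsLink e) :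
    ∑ v ∈ Γ.nodesOf C, Γ.degreeIn C v = 2 * C.card := by
  have h := Finset.sum_card_bipartiteAbove_eq_sum_card_bipartiteBelow
    (s := Γ.nodesOf C) (t := C) (fun (v : N) (e : E) => v ∈ Γ.ends e)
  have h1 : ∑ v ∈ Γ.nodesOf C, Γ.degreeIn C v =
      ∑ e ∈ C, ((Γ.nodesOf C).filter (fun v => v ∈ Γ.ends e)).card := by
    simpa only [Finset.bipartiteAbove, Finset.bipartiteBelow, degreeIn] using h
  rw [h1, Finset.sum_congr rfl (g := fun _ => 2), Finset.sum_const, smul_eq_mul, mul_comm]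
  intro e he
  rw [← hC e he]
  congr 1
  ext v
  simp only [Finset.mem_filter, mem_nodesOf]
  exact ⟨fun h => h.2, fun h => ⟨⟨e, he, h⟩, h⟩⟩

theorem circle_card {C : Finset E} (hC : Γ.IsCircle C) : (Γ.nodesOf C).card = C.card := by
  have h := Γ.deg_sum hC.2.1
  rw [Finset.sum_congr rfl hC.2.2.2, Finset.sum_const, smul_eq_mul] at h
  omega

theorem nodesOf_mono {S T : Finset E} (h : S ⊆ T) : Γ.nodesOf S ⊆ Γ.nodesOf T := by
  intro v hv
  obtain ⟨e, he, hv⟩ := Γ.mem_nodesOf.1 hv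
  exact Γ.mem_nodesOf.2 ⟨e, h he, hv⟩

theorem minimal_circle {C : Finset E} (hne : C.Nonempty) (hl : ∀ e ∈ C, Γ.IsLink e)
    (hc : (Γ.nodesOf C).card ≤ C.card)
    (hmin : ∀ D ⊂ C, D.Nonempty → D.card < (Γ.nodesOf D).card) : Γ.IsCircle C := by
  have hends : ∀ D ⊆ C, ∀ e ∈ D, 2 ≤ (Γ.nodesOf D).card := by
    intro D hD e he
    rw [← hl e (hD he)]
    exact Finset.card_le_card (fun v hv => Γ.mem_nodesOf.2 ⟨e, he, hv⟩)
  have her : ∀ e ∈ C, (C.erase e).card < (Γ.nodesOf (C.erase e)).card := by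
    intro e he
    apply hmin _ (Finset.erase_ssubset he)
    rw [← Finset.card_pos, Finset.card_erase_of_mem he]
    have := hends C subset_rfl e he
    omega
  have hnod : ∀ e ∈ C, Γ.nodesOf (C.erase e) = Γ.nodesOf C := by
    intro e he
    apply Finset.eq_of_subset_of_card_le (Γ.nodesOf_mono (Finset.erase_subset _ _))
    have h1 := her e he
    rw [Finset.card_erase_of_mem he] at h1
    omega
  have hcard : (Γ.nodesOf C).card = C.card := by
    obtain ⟨e, he⟩ := hne
    have h1 := her e he
    rw [Finset.card_erase_of_mem he, hnod e he] at h1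
    omega
  have hdeg2 : ∀ v ∈ Γ.nodesOf C, 2 ≤ Γ.degreeIn C v := by
    intro v hv
    obtain ⟨e, he, hve⟩ := Γ.mem_nodesOf.1 hv
    rw [← hnod e he] at hv
    obtain ⟨f, hf, hvf⟩ := Γ.mem_nodesOf.1 hv
    have : ({e, f} : Finset E) ⊆ C.filter (fun e => v ∈ Γ.ends e) := by
      intro x hx
      simp only [Finset.mem_insert, Finset.mem_singleton] at hx
      rcases hx with rfl | rfl
      · simp [he, hve]
      · simp [Finset.mem_of_mem_erase hf, hvf]
    have h2 := Finset.card_le_card this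
    rwa [Finset.card_pair (Finset.ne_of_mem_erase hf).symm] at h2
  refine ⟨hne, hl, ?_, ?_⟩
  · intro e he f hf
    by_contra hcon
    set R := (fun a b => a ∈ (↑C : Set E) ∧ b ∈ (↑C : Set E) ∧ ∃ v : N, v ∈ Γ.ends a ∧ v ∈ Γ.ends b)
      with hR
    have he' : e ∈ C := by simpa using he
    have hf' : f ∈ C := by simpa using hf
    let A := C.filter (fun x => Relation.ReflTransGen R e x)
    let B := C.filter (fun x => ¬ Relation.ReflTransGen R e x)
    have heA : e ∈ A := Finset.mem_filter.2 ⟨he', Relation.ReflTransGen.refl⟩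
    have hfB : f ∈ B := Finset.mem_filter.2 ⟨hf', hcon⟩
    have hAC : A ⊂ C := by
      refine ⟨Finset.filter_subset _ _, fun h => hcon (Finset.mem_filter.1 (h hf')).2⟩
    have hBC : B ⊂ C := by
      refine ⟨Finset.filter_subset _ _, fun h => (Finset.mem_filter.1 (h he')).2 .refl⟩
    have h1 := hmin A hAC ⟨e, heA⟩
    have h2 := hmin B hBC ⟨f, hfB⟩
    have h3 : A.card + B.card = C.card := Finset.card_filter_add_card_filter_not _
    have hdis : Disjoint (Γ.nodesOf A) (Γ.nodesOf B) := by
      rw [Finset.disjoint_left]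
      intro v hvA hvB
      obtain ⟨a, ha, hva⟩ := Γ.mem_nodesOf.1 hvA
      obtain ⟨b, hb, hvb⟩ := Γ.mem_nodesOf.1 hvB
      have ha := Finset.mem_filter.1 ha
      have hb := Finset.mem_filter.1 hb
      exact hb.2 (ha.2.tail ⟨ha.1, hb.1, v, hva, hvb⟩)
    have h4 : (Γ.nodesOf A).card + (Γ.nodesOf B).card ≤ (Γ.nodesOf C).card := by
      rw [← Finset.card_union_of_disjoint hdis]
      exact Finset.card_le_card (Finset.union_subset (Γ.nodesOf_mono hAC.1) (Γ.nodesOf_mono hBC.1))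
    omega
  · have hs := Γ.deg_sum hl
    have hs2 : ∑ v ∈ Γ.nodesOf C, 2 = ∑ v ∈ Γ.nodesOf C, Γ.degreeIn C v := by
      rw [hs, Finset.sum_const, smul_eq_mul]; omega
    intro v hv
    exact (((Finset.sum_eq_sum_iff_of_le hdeg2).1 hs2) v hv).symm

theorem exists_circle (n : ℕ) : ∀ S : Finset E, S.card = n → S.Nonempty → (∀ e ∈ S, Γ.IsLink e) →
    (Γ.nodesOf S).card ≤ S.card → ∃ C ⊆ S, Γ.IsCircle C := by
  induction n using Nat.strong_induction_on with
  | _ n ih =>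
    intro S hn hne hl hc
    by_cases h : ∃ D ⊂ S, D.Nonempty ∧ (Γ.nodesOf D).card ≤ D.card
    · obtain ⟨D, hD, hDn, hDc⟩ := h
      obtain ⟨C, hC, h⟩ := ih D.card (hn ▸ Finset.card_lt_card hD) D rfl hDn
        (fun e he => hl e (hD.1 he)) hDc
      exact ⟨C, hC.trans hD.1, h⟩
    · push Not at h
      exact ⟨S, subset_rfl, Γ.minimal_circle hne hl hc h⟩

theorem conn_union {S T : Finset E} (hS : Γ.ConnEdges ↑S) (hT : Γ.ConnEdges ↑T) {u : N}
    (huS : u ∈ Γ.nodesOf S) (huT : u ∈ Γ.nodesOf T) : Γ.ConnEdges (↑(S ∪ T) : Set E) := by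
  obtain ⟨a, ha, hua⟩ := Γ.mem_nodesOf.1 huS
  obtain ⟨b, hb, hub⟩ := Γ.mem_nodesOf.1 huT
  set R := (fun a b => a ∈ (↑(S ∪ T) : Set E) ∧ b ∈ (↑(S ∪ T) : Set E) ∧
    ∃ v : N, v ∈ Γ.ends a ∧ v ∈ Γ.ends b) with hR
  have mS : ∀ e ∈ S, ∀ f ∈ S, Relation.ReflTransGen R e f := fun e he f hf =>
    Relation.ReflTransGen.mono (fun x y ⟨h1, h2, h3⟩ => ⟨by simp_all, by simp_all, h3⟩) _ _ (hS e he f hf)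
  have mT : ∀ e ∈ T, ∀ f ∈ T, Relation.ReflTransGen R e f := fun e he f hf =>
    Relation.ReflTransGen.mono (fun x y ⟨h1, h2, h3⟩ => ⟨by simp_all, by simp_all, h3⟩) _ _ (hT e he f hf)
  have hab : R a b := ⟨by simp [ha], by simp [hb], u, hua, hub⟩
  have hba : R b a := ⟨by simp [hb], by simp [ha], u, hub, hua⟩
  intro e he f hf
  have he : e ∈ S ∪ T := he
  have hf : f ∈ S ∪ T := hf
  rcases Finset.mem_union.1 he with he | he <;> rcases Finset.mem_union.1 hf with hf | hf
  · exact mS e he f hf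
  · exact ((mS e he a ha).tail hab).trans (mT b hb f hf)
  · exact ((mT e he b hb).tail hba).trans (mS a ha f hf)
  · exact mT e he f hf

theorem theta_circle {P₂ P₃ : Finset E} {u v : N} (h2 : Γ.IsPath P₂ u v) (h3 : Γ.IsPath P₃ u v)
    (hd : Disjoint P₂ P₃)
    (hn : (↑(Γ.nodesOf P₂) ∩ ↑(Γ.nodesOf P₃) : Set N) = {u, v}) : Γ.IsCircle (P₂ ∪ P₃) := by
  obtain ⟨n2, huv, l2, c2, u2, v2, du2, dv2, d2⟩ := h2
  obtain ⟨n3, -, l3, c3, u3, v3, du3, dv3, d3⟩ := h3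
  have hdeg : ∀ w, Γ.degreeIn (P₂ ∪ P₃) w = Γ.degreeIn P₂ w + Γ.degreeIn P₃ w := by
    intro w
    unfold degreeIn
    rw [Finset.filter_union, Finset.card_union_of_disjoint]
    exact Finset.disjoint_filter_filter hd
  have hz : ∀ (Q : Finset E) w, w ∉ Γ.nodesOf Q → Γ.degreeIn Q w = 0 := by
    intro Q w hw
    unfold degreeIn
    rw [Finset.card_eq_zero, Finset.filter_eq_empty_iff]
    exact fun e he hwe => hw (Γ.mem_nodesOf.2 ⟨e, he, hwe⟩)
  refine ⟨n2.mono Finset.subset_union_left, ?_, Γ.conn_union c2 c3 u2 u3, ?_⟩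
  · intro e he
    rcases Finset.mem_union.1 he with he | he
    · exact l2 e he
    · exact l3 e he
  · intro w hw
    rw [hdeg]
    by_cases hwu : w = u
    · subst hwu; omega
    by_cases hwv : w = v
    · subst hwv; omega
    have hnot : ¬ (w ∈ Γ.nodesOf P₂ ∧ w ∈ Γ.nodesOf P₃) := by
      intro h
      have : w ∈ ({u, v} : Set N) := hn ▸ (show w ∈ (↑(Γ.nodesOf P₂) ∩ ↑(Γ.nodesOf P₃) : Set N) from
        ⟨h.1, h.2⟩)
      simp [hwu, hwv] at this
    obtain ⟨e, he, hwe⟩ := Γ.mem_nodesOf.1 hw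
    rcases Finset.mem_union.1 he with he | he
    · have hw2 : w ∈ Γ.nodesOf P₂ := Γ.mem_nodesOf.2 ⟨e, he, hwe⟩
      rw [d2 w hw2 hwu hwv, hz P₃ w (fun h => hnot ⟨hw2, h⟩)]
    · have hw3 : w ∈ Γ.nodesOf P₃ := Γ.mem_nodesOf.2 ⟨e, he, hwe⟩
      rw [d3 w hw3 hwu hwv, hz P₂ w (fun h => hnot ⟨h, hw3⟩)]

end gr
end MGraph

structure CD {P N E : Type*} (G : ProjGeom P) (Γ : MGraph N E) (b : N → Set P) (h : E → Set P) :
    Prop where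
  hb : ∀ v, G.IsHyperplane (b v)
  hh : ∀ e, G.IsHyperplane (h e)
  inj : Function.Injective h
  bpt : ∀ v, ∃ p, p ∉ b v ∧ ∀ w, w ≠ v → p ∈ b w
  bot : ∀ p, ∃ v, p ∉ b v
  prop : ∀ e, ∀ v ∈ Γ.ends e, ∀ w ∈ Γ.ends e, ∀ p, p ∈ h e → p ∈ b v → p ∈ b w
  gen : ∀ e p, (∀ v ∈ Γ.ends e, p ∈ b v) → p ∈ h e
  half : ∀ e, ¬ Γ.IsLink e → ∃ v ∈ Γ.ends e, h e ⊆ b v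
  ne : ∀ e, ∃ v, v ∈ Γ.ends e
  dec : ∀ A B : Set N, ∀ s, (∀ v, v ∈ A → v ∈ B → s ∈ b v) →
    (∀ v ∈ A, s ∈ b v) ∨ (∀ v ∈ B, s ∈ b v) ∨
      ∃ y z, (∀ v ∈ A, y ∈ b v) ∧ (∀ v ∈ B, z ∈ b v) ∧ s ∈ G.line y z

namespace CD
section cd
variable {P N E : Type*} {G : ProjGeom P} {Γ : MGraph N E} {b : N → Set P} {h : E → Set P}

def bal (G : ProjGeom P) (Γ : MGraph N E) (h : E → Set P) : Set (Finset E) :=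
  {C | Γ.IsCircle C ∧ G.codim (⋂ e ∈ C, h e) < C.card}

theorem binj (D : CD G Γ b h) : Function.Injective b := by
  intro v w hvw
  by_contra hne
  obtain ⟨p, hp, hp2⟩ := D.bpt v
  exact hp (hvw ▸ hp2 w (Ne.symm hne))

theorem bind (D : CD G Γ b h) (A : Finset N) : ProjGeom.HInd (A.image b) := by
  intro i hi hs
  obtain ⟨v, hv, rfl⟩ := Finset.mem_image.1 hi
  obtain ⟨p, hp, hp2⟩ := D.bpt v
  apply hp
  apply hs
  intro j hj
  have hj : j ∈ (A.image b).erase (b v) := hj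
  obtain ⟨hj1, hj2⟩ := Finset.mem_erase.1 hj
  obtain ⟨w, hw, rfl⟩ := Finset.mem_image.1 hj2
  exact hp2 w (fun h => hj1 (h ▸ rfl))

theorem himg (D : CD G Γ b h) (A : Finset N) : ∀ i ∈ A.image b, G.IsHyperplane i := by
  intro i hi
  obtain ⟨v, hv, rfl⟩ := Finset.mem_image.1 hi
  exact D.hb v

theorem hhimg (D : CD G Γ b h) (A : Finset E) : ∀ i ∈ A.image h, G.IsHyperplane i := by
  intro i hi
  obtain ⟨v, hv, rfl⟩ := Finset.mem_image.1 hi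
  exact D.hh v

theorem sInter_img {ι : Type*} (f : ι → Set P) (A : Finset ι) :
    ⋂₀ (↑(A.image f) : Set (Set P)) = ⋂ e ∈ A, f e := by
  ext x; simp

theorem lower (D : CD G Γ b h) {A : Finset N} {I : Finset (Set P)} (hI : ∀ i ∈ I, G.IsHyperplane i)
    (hind : ProjGeom.HInd I) (hs : ∀ p, (∀ v ∈ A, p ∈ b v) → ∀ i ∈ I, p ∈ i) :
    I.card ≤ A.card := by
  rw [← Finset.card_image_of_injective A D.binj]
  apply G.steinitz hI (D.himg A) hind
  intro i hi p hp
  rw [sInter_img] at hp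
  simp only [Set.mem_iInter] at hp
  exact hs p hp i hi

theorem upper (D : CD G Γ b h) {A : Finset N} {T : Finset (Set P)} (hT : ∀ i ∈ T, G.IsHyperplane i)
    (hs : ∀ p, p ∈ ⋂₀ (↑T : Set (Set P)) → ∀ v ∈ A, p ∈ b v) :
    A.card ≤ T.card := by
  rw [← Finset.card_image_of_injective A D.binj]
  apply G.steinitz (D.himg A) hT (D.bind A)
  intro i hi p hp
  obtain ⟨v, hv, rfl⟩ := Finset.mem_image.1 hi
  exact hs p hp v hv

theorem wit (D : CD G Γ b h) (C : Finset E) :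
    ∃ I : Finset (Set P), I.card = G.codim (⋂ e ∈ C, h e) ∧
      (∀ i ∈ I, G.IsHyperplane i) ∧ ⋂₀ (↑I : Set (Set P)) = (⋂ e ∈ C, h e) ∧ ProjGeom.HInd I := by
  have := G.codim_wit (D.hhimg C)
  rwa [sInter_img] at this

theorem conn_pt (D : CD G Γ b h) {S : Set E} (hS : Γ.ConnEdges S) {p : P} (hp : ∀ e ∈ S, p ∈ h e)
    {v w : N} (hv : v ∈ Γ.nodeSet S) (hw : w ∈ Γ.nodeSet S) (hpv : p ∈ b v) : p ∈ b w := by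
  obtain ⟨e, he, hve⟩ := hv
  obtain ⟨f, hf, hwf⟩ := hw
  have key : ∀ x ∈ Γ.ends f, p ∈ b x := by
    have := hS e he f hf
    clear hwf
    induction this with
    | refl => exact fun x hx => D.prop e v hve x hx p (hp e he) hpv
    | tail h1 h2 ih =>
      obtain ⟨ha, hb, y, hy1, hy2⟩ := h2
      exact fun x hx => D.prop _ y hy2 x hx p (hp _ hb) (ih ha y hy1)
  exact key w hwf

theorem nodeSet_coe (C : Finset E) (v : N) : v ∈ Γ.nodeSet (↑C : Set E) ↔ v ∈ Γ.nodesOf C := by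
  rw [MGraph.mem_nodesOf]; rfl

theorem gen_nodes (D : CD G Γ b h) {C : Finset E} {p : P} (hp : ∀ v ∈ Γ.nodesOf C, p ∈ b v) :
    p ∈ ⋂ e ∈ C, h e := by
  simp only [Set.mem_iInter]
  exact fun e he => D.gen e p (fun v hv => hp v (Γ.mem_nodesOf.2 ⟨e, he, hv⟩))

theorem circle_iff (D : CD G Γ b h) {C : Finset E} (hC : Γ.IsCircle C) {v : N}
    (hv : v ∈ Γ.nodesOf C) : C ∈ bal G Γ h ↔ ∃ p ∈ (⋂ e ∈ C, h e), p ∉ b v := by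
  obtain ⟨I, h1, h2, h3, h4⟩ := D.wit C
  have hc := Γ.circle_card hC
  constructor
  · rintro ⟨-, hlt⟩
    by_contra hcon
    push Not at hcon
    have := D.upper (A := Γ.nodesOf C) h2 (by
      intro p hp w hw
      rw [h3] at hp
      have hp' : ∀ e ∈ (↑C : Set E), p ∈ h e := by simpa using hp
      exact D.conn_pt hC.2.2.1 hp' ((nodeSet_coe C v).2 hv) ((nodeSet_coe C w).2 hw) (hcon p hp))
    omega
  · rintro ⟨p, hp, hpv⟩
    refine ⟨hC, ?_⟩
    have hn : ¬ (⋂₀ (↑I : Set (Set P)) ⊆ b v) := fun h => hpv (h (h3 ▸ hp))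
    obtain ⟨h5, h6⟩ := G.hind_insert h2 h4 (D.hb v) hn
    have := D.lower (A := Γ.nodesOf C) (I := insert (b v) I) (by
      intro i hi
      rcases Finset.mem_insert.1 hi with rfl | hi
      · exact D.hb v
      · exact h2 i hi) h6 (by
      intro q hq i hi
      rcases Finset.mem_insert.1 hi with rfl | hi
      · exact hq v hv
      · have := D.gen_nodes hq
        rw [← h3] at this
        exact this i hi)
    rw [Finset.card_insert_of_notMem h5] at this
    omega

theorem loc (D : CD G Γ b h) (A : Set N) {Y Z x : Set P} (hY : G.IsFlat Y) (hx : G.IsFlat x)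
    (hYA : ∀ p, (∀ v ∈ A, p ∈ b v) → p ∈ Y) (hZA : ∀ p, (∀ v ∉ A, p ∈ b v) → p ∈ Z)
    (hxA : ∀ p, (∀ v ∈ A, p ∈ b v) → p ∈ x) (hs : Y ∩ Z ⊆ x) : Y ⊆ x := by
  intro y hy
  rcases D.dec A Aᶜ y (fun v h1 h2 => absurd h1 h2) with h1 | h1 | ⟨c, a, hc, ha, hl⟩
  · exact hxA y h1
  · exact hs ⟨hy, hZA y h1⟩
  · have haZ := hZA a ha
    by_cases hyc : y = c
    · subst hyc; exact hxA y hc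
    · exact hx c (hxA c hc) a (hs ⟨G.flat_flip hY hl hyc (hYA c hc) hy, haZ⟩) hl

theorem finred [Fintype N] (D : CD G Γ b h) (S : Set E) : ∃ S₀ : Finset E, ↑S₀ ⊆ S ∧
    ProjGeom.HInd (S₀.image h) ∧ ∀ p ∈ (⋂ e ∈ S₀, h e), ∀ e ∈ S, p ∈ h e := by
  let Q : Set ℕ := {n | ∃ S₀ : Finset E, ↑S₀ ⊆ S ∧ ProjGeom.HInd (S₀.image h) ∧ S₀.card = n}
  have hne : Q.Nonempty := ⟨0, ∅, by simp, by intro i hi; simp at hi, by simp⟩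
  have hbd : BddAbove Q := by
    refine ⟨Fintype.card N, ?_⟩
    rintro n ⟨S₀, -, h2, rfl⟩
    rw [← Finset.card_image_of_injective S₀ D.inj]
    apply D.lower (A := Finset.univ) (D.hhimg S₀) h2
    intro p hp
    obtain ⟨v, hv⟩ := D.bot p
    exact absurd (hp v (Finset.mem_univ _)) hv
  obtain ⟨S₀, h1, h2, h3⟩ := Nat.sSup_mem hne hbd
  refine ⟨S₀, h1, h2, ?_⟩
  intro p hp e he
  by_contra hpe
  obtain ⟨h5, h6⟩ := G.hind_insert (D.hhimg S₀) h2 (D.hh e) (fun hs => hpe (hs (by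
    rw [sInter_img]; exact hp)))
  have hes : e ∉ S₀ := fun h' => h5 (Finset.mem_image_of_mem _ h')
  have : (insert e S₀).card ∈ Q := by
    refine ⟨_, ?_, ?_, rfl⟩
    · rw [Finset.coe_insert]; exact Set.insert_subset he h1
    · rwa [Finset.image_insert]
  have := le_csSup hbd this
  rw [Finset.card_insert_of_notMem hes] at this
  omega

theorem hind_mono {I J : Finset (Set P)} (hI : ProjGeom.HInd I) (hJ : J ⊆ I) : ProjGeom.HInd J := by
  intro i hi hs
  apply hI i (hJ hi)
  refine Set.Subset.trans (Set.sInter_subset_sInter ?_) hs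
  exact_mod_cast Finset.erase_subset_erase i hJ

theorem flat_cap (D : CD G Γ b h) (S : Set E) : G.IsFlat (⋂ e ∈ S, h e) :=
  G.flat_biInter S h (fun e _ => (D.hh e).1)

/-- The key lemma. -/
theorem key [Fintype N] (D : CD G Γ b h) {S : Set E} {v : N} (hv : (⋂ e ∈ S, h e) ⊆ b v) :
    ¬ Γ.IsBalancedSet (bal G Γ h) S := by
  rintro ⟨hl, hbal⟩
  obtain ⟨S₀, h1, h2, h3⟩ := D.finred S
  let A : Finset N := Finset.univ.filter (fun w => (⋂ e ∈ S₀, h e) ⊆ b w)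
  let T : Finset E := S₀.filter (fun e => ∀ w ∈ Γ.ends e, w ∈ A)
  have hvA : v ∈ A := by
    refine Finset.mem_filter.2 ⟨Finset.mem_univ _, fun p hp => hv ?_⟩
    simp only [Set.mem_iInter]; exact h3 p hp
  have hTA : ∀ w ∈ A, (⋂ e ∈ (↑T : Set E), h e) ⊆ b w := by
    intro w hw
    apply D.loc (↑A : Set N) (Z := ⋂ e ∈ {e | e ∈ S₀ ∧ e ∉ T}, h e) (D.flat_cap _) (D.hb w).1
    · intro p hp
      simp only [Set.mem_iInter]
      intro e he
      exact D.gen e p (fun u hu => hp u ((Finset.mem_filter.1 he).2 u hu))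
    · intro p hp
      simp only [Set.mem_iInter]
      rintro e ⟨he, heT⟩
      refine D.gen e p (fun u hu => hp u (fun huA => heT ?_))
      refine Finset.mem_filter.2 ⟨he, fun x hx => Finset.mem_filter.2 ⟨Finset.mem_univ _, ?_⟩⟩
      intro q hq
      have hqe : q ∈ h e := by simp only [Set.mem_iInter] at hq; exact hq e he
      exact D.prop e u hu x hx q hqe ((Finset.mem_filter.1 huA).2 hq)
    · intro p hp; exact hp w hw
    · refine Set.Subset.trans ?_ (Finset.mem_filter.1 hw).2
      rintro p ⟨hp1, hp2⟩
      simp only [Set.mem_iInter] at *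
      intro e he
      by_cases heT : e ∈ T
      · exact hp1 e heT
      · exact hp2 e ⟨he, heT⟩
  have hcard : A.card ≤ T.card := by
    rw [← Finset.card_image_of_injective T D.inj]
    apply D.upper (D.hhimg T)
    intro p hp w hw
    rw [sInter_img] at hp
    exact hTA w hw hp
  have hnod : (Γ.nodesOf T).card ≤ T.card := by
    refine le_trans (Finset.card_le_card ?_) hcard
    intro w hw
    obtain ⟨e, he, hwe⟩ := Γ.mem_nodesOf.1 hw
    exact (Finset.mem_filter.1 he).2 w hwe
  have hTS : T ⊆ S₀ := Finset.filter_subset _ _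
  obtain ⟨C, hCT, hC⟩ := Γ.exists_circle _ T rfl
    (by rw [← Finset.card_pos]; have := Finset.card_pos.2 ⟨v, hvA⟩; omega)
    (fun e he => hl e (h1 (hTS he))) hnod
  have hCB := hbal C (fun e he => h1 (hTS (hCT he))) hC
  obtain ⟨I, i1, i2, i3, i4⟩ := D.wit C
  have := G.steinitz (D.hhimg C) i2
    (hind_mono h2 (Finset.image_subset_image (hCT.trans hTS))) (by
      intro i hi
      rw [i3, ← sInter_img]
      exact Set.sInter_subset_of_mem (by exact_mod_cast hi))
  rw [Finset.card_image_of_injective C D.inj] at this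
  have := hCB.2
  omega

/-- Unbalanced sets pin down some node. -/
theorem unbal (D : CD G Γ b h) {S : Set E} (hS : ¬ Γ.IsBalancedSet (bal G Γ h) S) :
    ∃ v ∈ Γ.nodeSet S, (⋂ e ∈ S, h e) ⊆ b v := by
  unfold MGraph.IsBalancedSet at hS
  by_cases hl : ∀ e ∈ S, Γ.IsLink e
  · have : ∃ C : Finset E, ↑C ⊆ S ∧ Γ.IsCircle C ∧ C ∉ bal G Γ h := by
      by_contra hcon; push Not at hcon; exact hS ⟨hl, hcon⟩
    obtain ⟨C, hCS, hC, hCB⟩ := this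
    obtain ⟨e, he⟩ := hC.1
    obtain ⟨v, hv⟩ := D.ne e
    refine ⟨v, ⟨e, hCS he, hv⟩, ?_⟩
    intro p hp
    by_contra hpv
    apply hCB
    refine (D.circle_iff hC (Γ.mem_nodesOf.2 ⟨e, he, hv⟩)).2 ⟨p, ?_, hpv⟩
    simp only [Set.mem_iInter] at *
    exact fun f hf => hp f (hCS hf)
  · push Not at hl
    obtain ⟨e, he, hel⟩ := hl
    obtain ⟨v, hv, hs⟩ := D.half e hel
    exact ⟨v, ⟨e, he, hv⟩, (Set.biInter_subset_of_mem he).trans hs⟩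

theorem linear (D : CD G Γ b h) : Γ.IsLinearClass (bal G Γ h) := by
  refine ⟨fun C hC => hC.1, ?_⟩
  intro u v P₁ P₂ P₃ p1 p2 p3 d12 d13 d23 n12 n13 n23 b12 b13
  have hC := Γ.theta_circle p2 p3 d23 n23
  have hu : ∀ {Q R : Finset E}, Γ.IsPath Q u v → u ∈ Γ.nodesOf (Q ∪ R) := fun hQ =>
    Γ.nodesOf_mono Finset.subset_union_left hQ.2.2.2.2.1
  rw [D.circle_iff b12.1 (hu p1)] at b12
  rw [D.circle_iff b13.1 (hu p1)] at b13
  rw [D.circle_iff hC (hu p2)]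
  obtain ⟨p, hp, hpu⟩ := b12
  obtain ⟨q, hq, hqu⟩ := b13
  have fl : ∀ Q : Finset E, G.IsFlat (⋂ e ∈ Q, h e) := fun Q => D.flat_cap ↑Q
  have split : ∀ (Q R : Finset E) x, x ∈ (⋂ e ∈ Q ∪ R, h e) ↔
      x ∈ (⋂ e ∈ Q, h e) ∧ x ∈ (⋂ e ∈ R, h e) := by
    intro Q R x
    simp only [Set.mem_iInter, Finset.mem_union]
    exact ⟨fun H => ⟨fun e he => H e (Or.inl he), fun e he => H e (Or.inr he)⟩,
      fun H e he => he.elim (H.1 e) (H.2 e)⟩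
  rw [split] at hp hq
  by_cases hpq : p = q
  · subst hpq
    exact ⟨p, (split _ _ _).2 ⟨hp.2, hq.2⟩, hpu⟩
  obtain ⟨s, hsu, hps⟩ := G.hyper_meet (D.hb u) hqu hpq
  have hsp : p ≠ s := fun h => hpu (h ▸ hsu)
  have hsq : s ≠ q := fun h => hqu (h ▸ hsu)
  -- p ∈ line s q
  have hs_pq : s ∈ G.line p q := by
    rw [G.line_symm] at hps ⊢
    exact G.line_flip hps hpq
  have hs1 : s ∈ ⋂ e ∈ P₁, h e := fl P₁ _ hp.1 _ hq.1 hs_pq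
  have hsall : ∀ w ∈ Γ.nodesOf P₁, s ∈ b w := by
    intro w hw
    have hp' : ∀ e ∈ (↑P₁ : Set E), s ∈ h e := by simpa using hs1
    exact D.conn_pt p1.2.2.2.1 hp' ((nodeSet_coe P₁ u).2 p1.2.2.2.2.1) ((nodeSet_coe P₁ w).2 hw) hsu
  have caseY : s ∈ (⋂ e ∈ P₂, h e) → ∃ p ∈ (⋂ e ∈ P₂ ∪ P₃, h e), p ∉ b u := fun hsY =>
    ⟨q, (split _ _ _).2 ⟨G.flat_flip (fl P₂) hs_pq hsp.symm hp.2 hsY, hq.2⟩, hqu⟩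
  have caseZ : s ∈ (⋂ e ∈ P₃, h e) → ∃ p ∈ (⋂ e ∈ P₂ ∪ P₃, h e), p ∉ b u := fun hsZ =>
    ⟨p, (split _ _ _).2 ⟨hp.2, G.flat_flip' (fl P₃) hs_pq hsq hq.2 hsZ⟩, hpu⟩
  rcases D.dec (↑(Γ.nodesOf P₂)) (↑(Γ.nodesOf P₃)) s (by
      intro w h2 h3
      have : w ∈ ({u, v} : Set N) := n23 ▸ (show w ∈ (↑(Γ.nodesOf P₂) ∩ ↑(Γ.nodesOf P₃) : Set N) from
        ⟨h2, h3⟩)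
      rcases this with rfl | rfl
      · exact hsu
      · exact hsall _ p1.2.2.2.2.2.1) with H | H | ⟨y, z, hy, hz, hsyz⟩
  · exact caseY (D.gen_nodes H)
  · exact caseZ (D.gen_nodes H)
  have hyY := D.gen_nodes hy
  have hzZ := D.gen_nodes hz
  have hyu : y ∈ b u := hy u p2.2.2.2.2.1
  have hzu : z ∈ b u := hz u p3.2.2.2.2.1
  by_cases hyz : y = z
  · subst hyz
    rw [G.line_self, Set.mem_singleton_iff] at hsyz
    subst hsyz
    exact caseY hyY
  obtain ⟨r, hr1, hr2⟩ := G.veblen p q y z s hpq hyz (fun h => hpu (h ▸ hyu))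
    (fun h => hqu (h ▸ hzu)) hs_pq hsyz
  refine ⟨r, (split _ _ _).2 ⟨fl P₂ _ hp.2 _ hyY hr1, fl P₃ _ hq.2 _ hzZ hr2⟩, ?_⟩
  intro hru
  have e1 : r = y := by
    by_contra hne
    exact hpu (G.flat_flip' (D.hb u).1 hr1 hne hyu hru)
  have e2 : r = z := by
    by_contra hne
    exact hqu (G.flat_flip' (D.hb u).1 hr2 hne hzu hru)
  exact hyz (e1 ▸ e2)

end cd
end CD

namespace CD
section cd2
variable {P N E : Type*} {G : ProjGeom P} {Γ : MGraph N E} {b : N → Set P} {h : E → Set P}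

theorem nodeConn_symm {S : Set E} {u v : N} (huv : Γ.nodeConn S u v) : Γ.nodeConn S v u := by
  unfold MGraph.nodeConn at *
  induction huv with
  | refl => exact .refl
  | tail h1 h2 ih =>
    obtain ⟨e, he, h3, h4⟩ := h2
    exact .head ⟨e, he, h4, h3⟩ ih

theorem node_pt (D : CD G Γ b h) {S : Set E} {p : P} (hp : ∀ e ∈ S, p ∈ h e)
    {v w : N} (hvw : Γ.nodeConn S v w) (hpv : p ∈ b v) : p ∈ b w := by
  unfold MGraph.nodeConn at hvw
  induction hvw with
  | refl => exact hpv
  | tail h1 h2 ih =>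
    obtain ⟨e, he, h3, h4⟩ := h2
    exact D.prop e _ h3 _ h4 p (hp e he) ih

theorem comp_edge {S : Set E} {v : N} {e : E} (he : e ∈ S) {x y : N} (hx : x ∈ Γ.ends e)
    (hy : y ∈ Γ.ends e) (hxv : Γ.nodeConn S x v) : Γ.nodeConn S y v :=
  Relation.ReflTransGen.head ⟨e, he, hy, hx⟩ hxv

theorem rep_indep [Fintype N] (D : CD G Γ b h) {S : Set E} {v : N}
    (hbal : Γ.IsBalancedSet (bal G Γ h) (Γ.edgesIn S {u | Γ.nodeConn S u v}))
    (R : Finset N) (hR : ∀ r ∈ R, ¬ Γ.nodeConn S r v) :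
    ∃ p, (∀ e ∈ S, p ∈ h e) ∧ (∀ r ∈ R, p ∈ b r) ∧ p ∉ b v := by
  by_contra hcon
  push Not at hcon
  set W : Set N := {u | Γ.nodeConn S u v} with hW
  apply D.key (S := Γ.edgesIn S W) (v := v) _ hbal
  apply D.loc W (Z := (⋂ e ∈ {e | e ∈ S ∧ e ∉ Γ.edgesIn S W}, h e) ∩ ⋂ r ∈ R, b r)
    (D.flat_cap _) (D.hb v).1
  · intro p hp
    simp only [Set.mem_iInter]
    exact fun e he => D.gen e p (fun u hu => hp u (he.2 u hu))
  · intro p hp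
    constructor
    · simp only [Set.mem_iInter]
      rintro e ⟨he, heT⟩
      refine D.gen e p (fun u hu => hp u (fun huW => heT ⟨he, fun x hx => ?_⟩))
      exact comp_edge he hu hx huW
    · simp only [Set.mem_iInter]
      exact fun r hr => hp r (hR r hr)
  · exact fun p hp => hp v Relation.ReflTransGen.refl
  · rintro p ⟨h1, h2, h3⟩
    simp only [Set.mem_iInter] at h1 h2 h3
    refine hcon p (fun e he => ?_) h3
    by_cases hc : e ∈ Γ.edgesIn S W
    · exact h1 e hc
    · exact h2 e ⟨he, hc⟩

theorem rank_eq [Fintype N] (D : CD G Γ b h) (S : Finset E) :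
    Γ.frameRk (bal G Γ h) ↑S = G.codim (⋂ e ∈ S, h e) := by
  obtain ⟨I, i1, i2, i3, i4⟩ := D.wit S
  let BB : Set (Set N) := {W : Set N | W ∈ Γ.components (↑S : Set E) ∧
    Γ.IsBalancedSet (bal G Γ h) (Γ.edgesIn (↑S : Set E) W)}
  have hrep : ∀ W : BB, ∃ v : N, W.1 = {u | Γ.nodeConn (↑S : Set E) u v} := fun W => W.2.1
  choose r hr using hrep
  have rinj : Function.Injective r := by
    intro W W' hWW
    apply Subtype.ext
    rw [hr W, hr W', hWW]
  let R : Finset N := Finset.univ.image r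
  have hRc : R.card = Γ.numBalComponents (bal G Γ h) ↑S := by
    rw [Finset.card_image_of_injective _ rinj, Finset.card_univ, ← Nat.card_eq_fintype_card]
    rfl
  have hJ : ∀ R' : Finset N, R' ⊆ R → ∃ J : Finset (Set P), J.card = I.card + R'.card ∧
      (∀ i ∈ J, G.IsHyperplane i) ∧ ProjGeom.HInd J ∧
      ∀ p, p ∈ ⋂₀ (↑J : Set (Set P)) ↔ (∀ e ∈ S, p ∈ h e) ∧ ∀ v ∈ R', p ∈ b v := by
    intro R'
    induction R' using Finset.induction_on with
    | empty => exact fun _ => ⟨I, by simp, i2, i4, by rw [i3]; simp⟩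
    | insert v R' hv ih =>
      intro hsub
      obtain ⟨J, j1, j2, j3, j4⟩ := ih ((Finset.subset_insert _ _).trans hsub)
      obtain ⟨W, -, hWv⟩ := Finset.mem_image.1 (hsub (Finset.mem_insert_self _ _))
      have hWe : W.1 = {u | Γ.nodeConn (↑S : Set E) u v} := by rw [hr W, hWv]
      have hWb := W.2.2
      rw [hWe] at hWb
      obtain ⟨p, p1, p2, p3⟩ := D.rep_indep hWb R' (by
        intro x hx hxv
        obtain ⟨W', -, hWx⟩ := Finset.mem_image.1 (hsub (Finset.mem_insert_of_mem hx))
        have : W' = W := by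
          apply Subtype.ext
          rw [hWe, hr W', hWx]
          ext y
          exact ⟨fun hy => Relation.ReflTransGen.trans hy hxv,
            fun hy => Relation.ReflTransGen.trans hy (nodeConn_symm hxv)⟩
        apply hv
        rw [← hWv, ← this, hWx]
        exact hx)
      obtain ⟨h5, h6⟩ := G.hind_insert j2 j3 (D.hb v) (fun hs => p3 (hs ((j4 p).2 ⟨p1, p2⟩)))
      refine ⟨insert (b v) J, ?_, ?_, h6, ?_⟩
      · rw [Finset.card_insert_of_notMem h5, Finset.card_insert_of_notMem hv, j1]; omega
      · intro i hi
        rcases Finset.mem_insert.1 hi with rfl | hi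
        · exact D.hb v
        · exact j2 i hi
      · intro q
        rw [Finset.coe_insert, Set.sInter_insert, Set.mem_inter_iff, j4]
        simp only [Finset.mem_insert, forall_eq_or_imp]
        tauto
  obtain ⟨J, j1, j2, j3, j4⟩ := hJ R subset_rfl
  have hle : J.card ≤ Fintype.card N := by
    apply D.lower (A := Finset.univ) j2 j3
    intro p hp
    obtain ⟨v, hv⟩ := D.bot p
    exact absurd (hp v (Finset.mem_univ _)) hv
  have hge : Fintype.card N ≤ J.card := by
    apply D.upper (A := Finset.univ) j2
    intro p hp v _
    obtain ⟨hpS, hpR⟩ := (j4 p).1 hp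
    have hpS' : ∀ e ∈ (↑S : Set E), p ∈ h e := hpS
    by_cases hb : Γ.IsBalancedSet (bal G Γ h) (Γ.edgesIn ↑S {u | Γ.nodeConn (↑S : Set E) u v})
    · let W : BB := ⟨{u | Γ.nodeConn (↑S : Set E) u v}, ⟨v, rfl⟩, hb⟩
      have hvr : Γ.nodeConn (↑S : Set E) v (r W) := by
        have : v ∈ W.1 := Relation.ReflTransGen.refl
        rw [hr W] at this
        exact this
      exact D.node_pt hpS' (nodeConn_symm hvr) (hpR _ (Finset.mem_image_of_mem _ (Finset.mem_univ _)))
    · obtain ⟨w, ⟨e, he, hwe⟩, hw⟩ := D.unbal hb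
      refine D.node_pt hpS' (he.2 w hwe) (hw ?_)
      simp only [Set.mem_iInter]
      exact fun e he => hpS e he.1
  unfold MGraph.frameRk
  rw [← hRc, ← i1]
  omega

theorem codim_insert (D : CD G Γ b h) (S : Finset E) (e : E) :
    G.codim (⋂ f ∈ insert e S, h f) = G.codim (⋂ f ∈ S, h f) ↔ (⋂ f ∈ S, h f) ⊆ h e := by
  constructor
  · intro heq
    by_contra hn
    obtain ⟨I, i1, i2, i3, i4⟩ := D.wit S
    obtain ⟨J, j1, j2, j3, j4⟩ := D.wit (insert e S)
    rw [← i3] at hn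
    obtain ⟨h5, h6⟩ := G.hind_insert i2 i4 (D.hh e) hn
    have := G.steinitz (I := insert (h e) I) (T := J) (by
      intro i hi
      rcases Finset.mem_insert.1 hi with rfl | hi
      · exact D.hh e
      · exact i2 i hi) j2 h6 (by
      intro i hi p hp
      rw [j3] at hp
      simp only [Set.mem_iInter] at hp
      rcases Finset.mem_insert.1 hi with rfl | hi
      · exact hp e (Finset.mem_insert_self _ _)
      · have : p ∈ ⋂₀ (↑I : Set (Set P)) := by
          rw [i3]
          simp only [Set.mem_iInter]
          exact fun f hf => hp f (Finset.mem_insert_of_mem hf)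
        exact this i hi)
    rw [Finset.card_insert_of_notMem h5] at this
    omega
  · intro hs
    congr 1
    rw [Finset.set_biInter_insert]
    exact Set.inter_eq_right.2 hs

theorem closed_iff [Fintype N] (D : CD G Γ b h) (S : Set E) : Γ.FrameClosed (bal G Γ h) S ↔
      S = {e : E | (⋂ f ∈ S, h f) ⊆ h e} := by
  have h1 : Γ.FrameClosed (bal G Γ h) S ↔ ∀ e, (⋂ f ∈ S, h f) ⊆ h e → e ∈ S := by
    unfold MGraph.FrameClosed
    apply forall_congr'
    intro e
    apply imp_congr_left
    constructor
    · rintro ⟨S₀, hS, heq⟩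
      rw [D.rank_eq, D.rank_eq, D.codim_insert] at heq
      refine Set.Subset.trans ?_ heq
      exact Set.biInter_mono hS (fun _ _ => subset_rfl)
    · intro hs
      obtain ⟨S₀, k1, k2, k3⟩ := D.finred S
      refine ⟨S₀, k1, ?_⟩
      rw [D.rank_eq, D.rank_eq, D.codim_insert]
      refine Set.Subset.trans ?_ hs
      intro p hp
      simp only [Set.mem_iInter]
      exact k3 p hp
  rw [h1]
  constructor
  · intro H
    apply Set.Subset.antisymm
    · exact fun e he => Set.biInter_subset_of_mem he
    · exact H
  · intro H e he
    rw [H]; exact he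

theorem unbal_iff [Fintype N] (D : CD G Γ b h) (S : Set E) (hne : S.Nonempty)
    (hc : Γ.ConnEdges S) : ¬ Γ.IsBalancedSet (bal G Γ h) S ↔
        ∃ W : Set N, (⋂ e ∈ S, h e) = ⋂ v ∈ W, b v := by
  constructor
  · intro hu
    obtain ⟨v, hv, hs⟩ := D.unbal hu
    refine ⟨Γ.nodeSet S, Set.Subset.antisymm ?_ ?_⟩
    · intro p hp
      have hpv := hs hp
      simp only [Set.mem_iInter] at hp ⊢
      exact fun w hw => D.conn_pt hc hp hv hw hpv
    · intro p hp
      simp only [Set.mem_iInter] at hp ⊢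
      exact fun e he => D.gen e p (fun v hv => hp v ⟨e, he, hv⟩)
  · rintro ⟨W, hW⟩
    rcases W.eq_empty_or_nonempty with rfl | ⟨w, hw⟩
    · exfalso
      obtain ⟨e, he⟩ := hne
      apply (D.hh e).2.1
      rw [← Set.univ_subset_iff]
      refine Set.Subset.trans ?_ (Set.biInter_subset_of_mem he)
      rw [hW]; simp
    · apply D.key (v := w)
      rw [hW]
      exact Set.biInter_subset_of_mem hw

end cd2
end CD

namespace ProjGeom
section inst
variable {P N E : Type*} [Fintype N] (G : ProjGeom P) (ν : N → P)

def nb (v : N) : Set P := G.span (ν '' {u : N | u ≠ v})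

theorem nb_not (hν : Function.Injective ν) (hind : G.Indep (Set.range ν)) (v : N) :
    ν v ∉ G.nb ν v := by
  intro hv
  apply hind (ν v) ⟨v, rfl⟩
  refine G.span_mono' ?_ hv
  rintro _ ⟨u, hu, rfl⟩
  exact ⟨⟨u, rfl⟩, fun h => hu (hν h)⟩

theorem nb_mem {v w : N} (hvw : w ≠ v) : ν w ∈ G.nb ν v := G.sub_span _ ⟨w, hvw, rfl⟩

theorem nb_hyp (hν : Function.Injective ν) (hind : G.Indep (Set.range ν))
    (hspan : G.span (Set.range ν) = Set.univ) (v : N) : G.IsHyperplane (G.nb ν v) := by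
  apply G.hyper_of (G.flat_span _) (G.nb_not ν hν hind v)
  rw [← Set.univ_subset_iff, ← hspan]
  apply G.span_mono'
  rintro _ ⟨u, rfl⟩
  by_cases huv : u = v
  · subst huv; exact Or.inr rfl
  · exact Or.inl (G.nb_mem ν huv)

theorem nb_inter (hν : Function.Injective ν) (hind : G.Indep (Set.range ν))
    (hspan : G.span (Set.range ν) = Set.univ) (A : Finset N) :
    ∀ p, (∀ v ∈ A, p ∈ G.nb ν v) → p ∈ G.span (ν '' {u | u ∉ A}) := by
  induction A using Finset.induction_on with
  | empty => intro p _; simp [hspan]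
  | insert a A ha ih =>
    intro p hp
    have h1 := ih p (fun v hv => hp v (Finset.mem_insert_of_mem hv))
    have hpa := hp a (Finset.mem_insert_self _ _)
    have hset : ν '' {u | u ∉ A} ⊆ ν '' {u | u ∉ insert a A} ∪ {ν a} := by
      rintro _ ⟨u, hu, rfl⟩
      by_cases hua : u = a
      · subst hua; exact Or.inr rfl
      · exact Or.inl ⟨u, by simp [hua]; exact hu, rfl⟩
    have hsub : G.span (ν '' {u | u ∉ insert a A}) ⊆ G.nb ν a := by
      apply G.span_mono'
      rintro _ ⟨u, hu, rfl⟩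
      exact ⟨u, fun h => hu (by simp [show u = a from h]), rfl⟩
    rcases G.mem_span_insert (G.span_mono' hset h1) with h2 | ⟨x, hx, h2⟩
    · exact absurd (h2 ▸ hpa) (G.nb_not ν hν hind a)
    · by_cases hpx : p = x
      · rwa [hpx]
      · exact absurd (G.flat_flip (G.flat_span _) h2 hpx (hsub hx) hpa) (G.nb_not ν hν hind a)

theorem nb_of_span {A : Set N} {p : P} (hp : p ∈ G.span (ν '' {u | u ∉ A})) :
    ∀ v ∈ A, p ∈ G.nb ν v := by
  intro v hv
  refine G.span_mono' ?_ hp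
  rintro _ ⟨u, hu, rfl⟩
  exact ⟨u, fun h => hu ((show u = v from h) ▸ hv), rfl⟩

theorem cd_of (hν : Function.Injective ν) (hind : G.Indep (Set.range ν))
    (hspan : G.span (Set.range ν) = Set.univ)
    (Γ : MGraph N E) (apex : E → P) (hcev : G.IsCevian ν Γ apex)
    (hinj : Function.Injective (G.cevHyp ν Γ apex)) :
    CD G Γ (G.nb ν) (G.cevHyp ν Γ apex) := by
  have inter := G.nb_inter ν hν hind hspan
  -- facts about links
  have hlink : ∀ e v w, v ≠ w → Γ.ends e = ({v, w} : Finset N) → apex e ∈ G.line (ν v) (ν w) →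
      apex e ∉ Set.range ν → ν v ∉ G.cevHyp ν Γ apex e ∧ G.IsHyperplane (G.cevHyp ν Γ apex e) := by
    intro e v w hvw he ha har
    have hl : Γ.IsLink e := by unfold MGraph.IsLink; rw [he, Finset.card_pair hvw]
    have hav : apex e ≠ ν v := fun h => har ⟨v, h.symm⟩
    have hset : G.cevHyp ν Γ apex e = G.span ((ν '' {u : N | u ∉ Γ.ends e}) ∪ {apex e}) := by
      unfold cevHyp; rw [if_pos hl]
    have hn : ν v ∉ G.cevHyp ν Γ apex e := by
      rw [hset]
      intro hmem
      rcases G.mem_span_insert hmem with h1 | ⟨x, hx, h1⟩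
      · exact hav h1.symm
      · have hx' := G.nb_of_span ν (A := {u | u ∈ Γ.ends e}) hx
        have hxv : x ∈ G.nb ν v := hx' v (by simp [he])
        have hxw : x ∈ G.nb ν w := hx' w (by simp [he])
        have hvx : ν v ≠ x := fun h => G.nb_not ν hν hind v (h ▸ hxv)
        -- apex in nb w
        have haw : apex e ∈ G.nb ν w :=
          G.flat_flip (G.flat_span _) h1 hvx hxw (G.nb_mem ν hvw)
        exact G.nb_not ν hν hind w
          (G.flat_flip (G.flat_span _) ha hav (G.nb_mem ν hvw) haw)
    refine ⟨hn, ?_⟩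
    have hfl : G.IsFlat (G.cevHyp ν Γ apex e) := by rw [hset]; exact G.flat_span _
    apply G.hyper_of hfl hn
    rw [← Set.univ_subset_iff, ← hspan]
    apply G.span_le (G.flat_span _)
    have hvm : ν v ∈ G.span (G.cevHyp ν Γ apex e ∪ {ν v}) := G.sub_span _ (Or.inr rfl)
    have ham : apex e ∈ G.span (G.cevHyp ν Γ apex e ∪ {ν v}) := by
      refine G.sub_span _ (Or.inl ?_)
      rw [hset]; exact G.sub_span _ (Or.inr rfl)
    rintro _ ⟨u, rfl⟩
    by_cases huv : u = v
    · subst huv; exact hvm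
    by_cases huw : u = w
    · subst huw
      exact G.flat_flip (G.flat_span _) ha hav hvm ham
    · refine G.sub_span _ (Or.inl ?_)
      rw [hset]
      exact G.sub_span _ (Or.inl ⟨u, by simp [he, huv, huw], rfl⟩)
  have hhalf : ∀ e v, Γ.ends e = ({v} : Finset N) →
      ¬ Γ.IsLink e ∧ G.cevHyp ν Γ apex e = G.nb ν v := by
    intro e v he
    have hl : ¬ Γ.IsLink e := by unfold MGraph.IsLink; rw [he, Finset.card_singleton]; omega
    refine ⟨hl, ?_⟩
    unfold cevHyp nb
    rw [if_neg hl, he]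
    simp
  have hgen : ∀ e p, (∀ v ∈ Γ.ends e, p ∈ G.nb ν v) → p ∈ G.cevHyp ν Γ apex e := by
    intro e p hp
    have := inter (Γ.ends e) p hp
    unfold cevHyp
    split_ifs
    · exact G.span_mono' Set.subset_union_left this
    · exact this
  have hhyp : ∀ e, G.IsHyperplane (G.cevHyp ν Γ apex e) := by
    intro e
    rcases hcev e with ⟨v, w, hvw, he, ha, har⟩ | ⟨v, he, -⟩
    · exact (hlink e v w hvw he ha har).2
    · rw [(hhalf e v he).2]; exact G.nb_hyp ν hν hind hspan v
  have hlp : ∀ e v w, v ≠ w → Γ.ends e = ({v, w} : Finset N) → apex e ∈ G.line (ν v) (ν w) →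
      apex e ∉ Set.range ν → ∀ p, p ∈ G.cevHyp ν Γ apex e → p ∈ G.nb ν w → p ∈ G.nb ν v := by
    intro e v w hvw he ha har p hp hpw
    refine G.exch (X := G.nb ν w) (h1 := G.cevHyp ν Γ apex e) (G.flat_span _) (hhyp e).1
      (G.nb_hyp ν hν hind hspan v) ?_ ?_ ⟨hpw, hp⟩
    · rintro q ⟨hq1, hq2⟩
      apply hgen
      intro u hu
      rw [he] at hu
      simp only [Finset.mem_insert, Finset.mem_singleton] at hu
      rcases hu with rfl | rfl
      · exact hq2
      · exact hq1
    · exact fun hs => (hlink e v w hvw he ha har).1 (hs (G.nb_mem ν hvw))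
  refine ⟨G.nb_hyp ν hν hind hspan, hhyp, hinj, ?_, ?_, ?_, hgen, ?_, ?_, ?_⟩
  · exact fun v => ⟨ν v, G.nb_not ν hν hind v, fun w hw => G.nb_mem ν hw.symm⟩
  · intro p
    by_contra hcon
    push Not at hcon
    have := inter Finset.univ p (fun v _ => hcon v)
    simp [G.span_empty'] at this
  · intro e x hx y hy p hp hpx
    rcases hcev e with ⟨v, w, hvw, he, ha, har⟩ | ⟨v, he, -⟩
    · rw [he] at hx hy
      simp only [Finset.mem_insert, Finset.mem_singleton] at hx hy
      rcases hx with rfl | rfl <;> rcases hy with rfl | rfl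
      · exact hpx
      · exact hlp e _ _ hvw.symm (by rw [he, Finset.pair_comm]) (by rwa [G.line_symm]) har p hp hpx
      · exact hlp e _ _ hvw he ha har p hp hpx
      · exact hpx
    · rw [he, Finset.mem_singleton] at hx hy
      subst hx; subst hy; exact hpx
  · intro e hel
    rcases hcev e with ⟨v, w, hvw, he, ha, har⟩ | ⟨v, he, -⟩
    · exact absurd (by unfold MGraph.IsLink; rw [he, Finset.card_pair hvw]) hel
    · exact ⟨v, by simp [he], (hhalf e v he).2.subset⟩
  · intro e
    rcases hcev e with ⟨v, w, hvw, he, ha, har⟩ | ⟨v, he, -⟩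
    · exact ⟨v, by simp [he]⟩
    · exact ⟨v, by simp [he]⟩
  · intro A B s hs
    have h1 := inter (Finset.univ.filter (fun v => v ∈ A ∧ v ∈ B)) s (by simpa using hs)
    have h2 : ν '' {u | u ∉ Finset.univ.filter (fun v => v ∈ A ∧ v ∈ B)} ⊆
        ν '' {u | u ∉ A} ∪ ν '' {u | u ∉ B} := by
      rintro _ ⟨u, hu, rfl⟩
      by_cases huA : u ∈ A
      · exact Or.inr ⟨u, fun huB => hu (by simp [huA, huB]), rfl⟩
      · exact Or.inl ⟨u, huA, rfl⟩
    rcases G.span_union_sub _ _ (G.span_mono' h2 h1) with (h3 | h3) | ⟨y, hy, z, hz, h3⟩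
    · exact Or.inl (G.nb_of_span ν h3)
    · exact Or.inr (Or.inl (G.nb_of_span ν h3))
    · exact Or.inr (Or.inr ⟨y, z, G.nb_of_span ν hy, G.nb_of_span ν hz, h3⟩)

end inst
end ProjGeom

/-- Let `A` be a Cevian arrangement of apical hyperplanes over a
point basis `N̂ = ν(N)` of a projective geometry, with associated graph `Γ`, rank
function `rk_P`, and balanced circles `B = {C : rk_P(C) < #C}`.  Then: (1) `B` is a
linear class, so `Ω(A) = (Γ, B)` is a biased graph; (2) `e ↦ h(ê)` is an
isomorphism of the frame matroid `G(Ω(A))` onto the matroid `M(A)` of the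
hyperplanes (rank = codimension of the intersection); (3) the intersection flats
of `A` correspond to the closed sets of `G(Ω(A))` via `t ↦ {e : h(ê) ⊇ t}`; and
(4) a connected nonempty edge set `S` is unbalanced if and only if
`⋂_{e∈S} h(ê)` is an intersection of node hyperplanes. -/
theorem stmt9 {P N E : Type*} [Fintype N] (G : ProjGeom P) (ν : N → P)
    (hν : Function.Injective ν) (hind : G.Indep (Set.range ν))
    (hspan : G.span (Set.range ν) = Set.univ)
    (Γ : MGraph N E) (apex : E → P) (hcev : G.IsCevian ν Γ apex)
    (hinj : Function.Injective (G.cevHyp ν Γ apex)) :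
    Γ.IsLinearClass (G.cevBal ν Γ apex) ∧
    (∀ S : Finset E, Γ.frameRk (G.cevBal ν Γ apex) ↑S = G.cevRk ν Γ apex S) ∧
    (∀ S : Set E, Γ.FrameClosed (G.cevBal ν Γ apex) S ↔
      S = {e : E | (⋂ f ∈ S, G.cevHyp ν Γ apex f) ⊆ G.cevHyp ν Γ apex e}) ∧
    (∀ S : Set E, S.Nonempty → Γ.ConnEdges S →
      (¬ Γ.IsBalancedSet (G.cevBal ν Γ apex) S ↔
        ∃ W : Set N, (⋂ e ∈ S, G.cevHyp ν Γ apex e)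
          = ⋂ v ∈ W, G.span (ν '' {u : N | u ≠ v}))) := by
  have D := G.cd_of ν hν hind hspan Γ apex hcev hinj
  exact ⟨D.linear, D.rank_eq, D.closed_iff, D.unbal_iff⟩
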